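/- arXiv:0807.2196 — 2 statements merged into one kernel-verified Lean document; each statement's English description precedes it below -/
import Mathlib

section
/- Let D be a bounded open subset of R^d, a ∈ (0,|D|), and let Ω* solve the problem: minimize λ₁(Ω) over open Ω ⊂ D with |Ω| = a. Then the distribution Δu_{Ω*} + λ₁(Ω*)·u_{Ω*} is nonnegative in D, i.e. it is a positive Radon measure on D. -/
open MeasureTheory Filter Metric Set
open scoped RealInnerProductSpace ENNReal Topology NNReal

noncomputable section

abbrev Euc (d : ℕ) := EuclideanSpace ℝ (Fin d)

variable {d : ℕ}

/-- Real-valued Lebesgue volume of a set. -/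
def mvol (s : Set (Euc d)) : ℝ := (volume s).toReal

/-- Smooth scalar test function compactly supported in `Ω`. -/
def TestFun (Ω : Set (Euc d)) (φ : Euc d → ℝ) : Prop :=
  ContDiff ℝ (⊤ : ℕ∞) φ ∧ HasCompactSupport φ ∧ tsupport φ ⊆ Ω

/-- Smooth vector field compactly supported in `Ω`. -/
def VecTestFun (Ω : Set (Euc d)) (Φ : Euc d → Euc d) : Prop :=
  ContDiff ℝ (⊤ : ℕ∞) Φ ∧ HasCompactSupport Φ ∧ tsupport Φ ⊆ Ω

/-- Membership in `H¹₀(Ω)`, encoded through `L²` integrability of the function and of its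
(a.e. defined) gradient, together with approximation in the `H¹` norm by smooth functions
compactly supported in `Ω`. -/
def MemH10 (Ω : Set (Euc d)) (v : Euc d → ℝ) : Prop :=
  MemLp v 2 (volume : Measure (Euc d)) ∧
  MemLp (fun x => gradient v x) 2 (volume : Measure (Euc d)) ∧
  ∃ φ : ℕ → Euc d → ℝ, (∀ n, TestFun Ω (φ n)) ∧
    Tendsto (fun n => ∫ x, ((v x - φ n x) ^ 2 + ‖gradient v x - gradient (φ n) x‖ ^ 2))
      atTop (nhds 0)

/-- First Dirichlet eigenvalue of `Ω`, via the Rayleigh quotient variational characterization. -/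
def lam1 (Ω : Set (Euc d)) : ℝ :=
  sInf {t : ℝ | ∃ v : Euc d → ℝ, MemH10 Ω v ∧ (∫ x, (v x) ^ 2) = 1 ∧
    t = ∫ x, ‖gradient v x‖ ^ 2}

/-- `u` is a normalized first Dirichlet eigenfunction of `Ω`. -/
def IsFirstEigenfun (Ω : Set (Euc d)) (u : Euc d → ℝ) : Prop :=
  MemH10 Ω u ∧ (∫ x, (u x) ^ 2) = 1 ∧ (∫ x, ‖gradient u x‖ ^ 2) = lam1 Ω ∧
  ∀ φ : Euc d → ℝ, TestFun Ω φ →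
    (∫ x, ⟪gradient u x, gradient φ x⟫) = lam1 Ω * ∫ x, u x * φ x

/-- `Ω` solves the shape optimization problem: it minimizes `λ₁` among open subsets of `D` of
measure `a`. -/
structure IsOptimalShape (D : Set (Euc d)) (a : ℝ) (Ω : Set (Euc d)) : Prop where
  isOpen : IsOpen Ω
  subset : Ω ⊆ D
  meas : mvol Ω = a
  minim : ∀ Ω' : Set (Euc d), IsOpen Ω' → Ω' ⊆ D → mvol Ω' = a → lam1 Ω ≤ lam1 Ω'

/-- `u` is locally Lipschitz continuous in `s`. -/
def LocLipOn (s : Set (Euc d)) (u : Euc d → ℝ) : Prop :=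
  ∀ x ∈ s, ∃ t, t ∈ 𝓝 x ∧ t ⊆ s ∧ ∃ K : ℝ≥0, LipschitzOnWith K u t

/-- Divergence of a vector field. -/
def divg (Φ : Euc d → Euc d) (x : Euc d) : ℝ :=
  ∑ i, fderiv ℝ Φ x (EuclideanSpace.single i 1) i

/-- `Ω` has locally finite perimeter in `D` (its characteristic function has locally bounded
variation in `D`). -/
def HasLocFinPerimeterIn (D Ω : Set (Euc d)) : Prop :=
  ∀ K : Set (Euc d), IsCompact K → K ⊆ D → ∃ C : ℝ,
    ∀ Φ : Euc d → Euc d, VecTestFun K Φ → (∀ x, ‖Φ x‖ ≤ 1) →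
      (∫ x in Ω, divg Φ x) ≤ C

/-- The reduced boundary of `Ω`: points where `Ω` blows up to a half space, in the sense that the
symmetric difference with a half space is of vanishing density. -/
def reducedBoundary (Ω : Set (Euc d)) : Set (Euc d) :=
  {x | ∃ ν : Euc d, ‖ν‖ = 1 ∧
    Tendsto (fun r : ℝ =>
        volume (symmDiff (Ω ∩ ball x r) ({y | ⟪y - x, ν⟫ ≤ 0} ∩ ball x r)) /
          ENNReal.ofReal (r ^ d))
      (𝓝[>] 0) (𝓝 0)}

/-- `S` is an analytic hypersurface in `D`: near each of its points in `D` it is the zero set of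
an analytic function with nonvanishing gradient. -/
def IsAnalyticHypersurfaceIn (D S : Set (Euc d)) : Prop :=
  ∀ x ∈ S ∩ D, ∃ U : Set (Euc d), IsOpen U ∧ x ∈ U ∧ U ⊆ D ∧
    ∃ f : Euc d → ℝ, AnalyticOn ℝ f U ∧ (∀ y ∈ U, fderiv ℝ f y ≠ 0) ∧
      S ∩ U = {y ∈ U | f y = 0}

/-- The functional `J(v) = ∫ |∇v|² - λ ∫ v²`. -/
def Jfun (lam : ℝ) (v : Euc d → ℝ) : ℝ :=
  (∫ x, ‖gradient v x‖ ^ 2) - lam * ∫ x, (v x) ^ 2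

/-- `Ω_v = {x ∈ D : v(x) ≠ 0}`. -/
def Om (D : Set (Euc d)) (v : Euc d → ℝ) : Set (Euc d) := {x ∈ D | v x ≠ 0}

/-- The optimal value `λ_a` of `λ₁` among open subsets of `D` of measure `a`. -/
def lamOpt (D : Set (Euc d)) (a : ℝ) : ℝ :=
  sInf {t : ℝ | ∃ Ω : Set (Euc d), IsOpen Ω ∧ Ω ⊆ D ∧ mvol Ω = a ∧ t = lam1 Ω}

/-- `u` minimizes `J` among functions of `H¹₀(D)` with `|Ω_w| ≤ a`. -/
def IsJMinimizer (D : Set (Euc d)) (a lam : ℝ) (u : Euc d → ℝ) : Prop :=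
  MemH10 D u ∧ mvol (Om D u) ≤ a ∧
  ∀ w : Euc d → ℝ, MemH10 D w → mvol (Om D w) ≤ a → Jfun lam u ≤ Jfun lam w

/-- The class `F` of perturbations of `u` supported in `B`. -/
def Fcal (D B : Set (Euc d)) (u v : Euc d → ℝ) : Prop :=
  MemH10 D v ∧ MemH10 B (fun x => u x - v x)

/-- The set of penalization constants `μ₋` admissible for `h` (inward perturbations). -/
def Mminus (D : Set (Euc d)) (a lam : ℝ) (u : Euc d → ℝ) (B : Set (Euc d)) (h : ℝ) :
    Set ℝ :=
  {μ : ℝ | 0 ≤ μ ∧ ∀ v : Euc d → ℝ, Fcal D B u v →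
    a - h ≤ mvol (Om D v) → mvol (Om D v) ≤ a →
    Jfun lam u + μ * mvol (Om D u) ≤ Jfun lam v + μ * mvol (Om D v)}

/-- The set of penalization constants `μ₊` admissible for `h` (outward perturbations). -/
def Mplus (D : Set (Euc d)) (a lam : ℝ) (u : Euc d → ℝ) (B : Set (Euc d)) (h : ℝ) :
    Set ℝ :=
  {μ : ℝ | 0 ≤ μ ∧ ∀ v : Euc d → ℝ, Fcal D B u v →
    a ≤ mvol (Om D v) → mvol (Om D v) ≤ a + h →
    Jfun lam u + μ * mvol (Om D u) ≤ Jfun lam v + μ * mvol (Om D v)}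

/-- `μ₋(h)`: the biggest admissible inward penalization constant. -/
def muMinus (D : Set (Euc d)) (a lam : ℝ) (u : Euc d → ℝ) (B : Set (Euc d)) (h : ℝ) : ℝ :=
  sSup (Mminus D a lam u B h)

/-- `μ₊(h)`: the smallest admissible outward penalization constant. -/
def muPlus (D : Set (Euc d)) (a lam : ℝ) (u : Euc d → ℝ) (B : Set (Euc d)) (h : ℝ) : ℝ :=
  sInf (Mplus D a lam u B h)

/-- Average of `u` on the sphere `∂B(x,r)`, with respect to the `(d-1)`-Hausdorff measure. -/
def sphAvg (u : Euc d → ℝ) (x : Euc d) (r : ℝ) : ℝ :=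
  (∫ y in sphere x r, u y ∂(μH[(d : ℝ) - 1])) / ((μH[(d : ℝ) - 1]) (sphere x r)).toReal

lemma aux_smooth (ε : ℝ) (hε : 0 < ε) : ∃ g : ℝ → ℝ, ContDiff ℝ (⊤ : ℕ∞) g ∧
    (∀ s, s ≤ 0 → g s = 0) ∧ (∀ s, |deriv g s| ≤ 1) ∧
    (∀ s, (max s 0) ^ 2 ≤ (g s) ^ 2 + 2 * ε * max s 0) := by
  have hc : ContDiff ℝ (⊤ : ℕ∞) (fun x : ℝ => Real.smoothTransition (x / ε)) :=
    Real.smoothTransition.contDiff.comp (contDiff_id.div_const ε)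
  have hcc := hc.continuous
  have hd : ∀ s, HasDerivAt (fun s : ℝ => ∫ x in (0:ℝ)..s, Real.smoothTransition (x / ε))
      (Real.smoothTransition (s / ε)) s := fun s =>
    intervalIntegral.integral_hasDerivAt_right (hcc.intervalIntegrable _ _)
      hcc.aestronglyMeasurable.stronglyMeasurableAtFilter hcc.continuousAt
  have hde : deriv (fun s : ℝ => ∫ x in (0:ℝ)..s, Real.smoothTransition (x / ε))
      = fun s => Real.smoothTransition (s / ε) := funext fun s => (hd s).deriv
  refine ⟨fun s => ∫ x in (0:ℝ)..s, Real.smoothTransition (x / ε), ?_, ?_, ?_, ?_⟩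
  · rw [contDiff_infty_iff_deriv]
    exact ⟨fun s => (hd s).differentiableAt, by rw [hde]; exact hc⟩
  · intro s hs
    have : ∫ x in (0:ℝ)..s, Real.smoothTransition (x / ε) = ∫ x in (0:ℝ)..s, (0:ℝ) := by
      apply intervalIntegral.integral_congr
      intro x hx
      rw [uIcc_of_ge hs] at hx
      exact Real.smoothTransition.zero_of_nonpos (div_nonpos_of_nonpos_of_nonneg hx.2 hε.le)
    simpa using this
  · intro s
    rw [hde, abs_of_nonneg (Real.smoothTransition.nonneg _)]
    exact Real.smoothTransition.le_one _
  · intro s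
    rcases le_total s ε with h | h
    · have h1 : max s 0 ≤ ε := max_le h hε.le
      have h2 : 0 ≤ max s 0 := le_max_right _ _
      nlinarith [sq_nonneg (∫ x in (0:ℝ)..s, Real.smoothTransition (x / ε))]
    · have h0 : max s 0 = s := max_eq_left (hε.le.trans h)
      have h1 : s - ε ≤ ∫ x in (0:ℝ)..s, Real.smoothTransition (x / ε) := by
        rw [← intervalIntegral.integral_add_adjacent_intervals
          (hcc.intervalIntegrable 0 ε) (hcc.intervalIntegrable ε s)]
        have a1 : 0 ≤ ∫ x in (0:ℝ)..ε, Real.smoothTransition (x / ε) :=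
          intervalIntegral.integral_nonneg hε.le fun x _ => Real.smoothTransition.nonneg _
        have a2 : ∫ x in ε..s, Real.smoothTransition (x / ε) = ∫ x in ε..s, (1:ℝ) := by
          apply intervalIntegral.integral_congr
          intro x hx
          rw [uIcc_of_le h] at hx
          exact Real.smoothTransition.one_of_one_le ((one_le_div hε).2 hx.1)
        rw [a2]
        simp
        exact a1
      rw [h0]
      simp only
      nlinarith [sq_nonneg ε, mul_self_le_mul_self (sub_nonneg.2 h) h1]

lemma norm_grad (f : Euc d → ℝ) (x : Euc d) : ‖gradient f x‖ = ‖fderiv ℝ f x‖ := by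
  simp [gradient]

lemma grad_memLp {Ω : Set (Euc d)} {φ : Euc d → ℝ} (h : TestFun Ω φ) :
    MemLp (fun x => gradient φ x) 2 (volume : Measure (Euc d)) := by
  have h1 : Continuous (fun x => gradient φ x) :=
    (InnerProductSpace.toDual ℝ (Euc d)).symm.continuous.comp
      (h.1.continuous_fderiv (by simp))
  have h2 : HasCompactSupport (fun x => gradient φ x) :=
    (h.2.1.fderiv (𝕜 := ℝ)).comp_left (g := (InnerProductSpace.toDual ℝ (Euc d)).symm) (by simp)
  exact h1.memLp_of_hasCompactSupport h2

lemma test_memLp {Ω : Set (Euc d)} {φ : Euc d → ℝ} (h : TestFun Ω φ) :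
    MemLp φ 2 (volume : Measure (Euc d)) :=
  h.1.continuous.memLp_of_hasCompactSupport h.2.1

lemma test_memH10 {Ω : Set (Euc d)} {φ : Euc d → ℝ} (h : TestFun Ω φ) : MemH10 Ω φ :=
  ⟨test_memLp h, grad_memLp h, fun _ => φ, fun _ => h, by simp⟩

lemma lam1_nonneg (Ω : Set (Euc d)) : 0 ≤ lam1 Ω := by
  apply Real.sInf_nonneg
  rintro t ⟨v, -, -, rfl⟩
  exact integral_nonneg fun x => by positivity

lemma lam1_le {Ω : Set (Euc d)} {w : Euc d → ℝ} (h : TestFun Ω w) :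
    lam1 Ω * ∫ x, (w x) ^ 2 ≤ ∫ x, ‖gradient w x‖ ^ 2 := by
  have hn : 0 ≤ ∫ x, (w x) ^ 2 := integral_nonneg fun x => by positivity
  rcases hn.eq_or_lt with h0 | h0
  · rw [← h0, mul_zero]
    exact integral_nonneg fun x => by positivity
  set I := ∫ x, (w x) ^ 2 with hI
  have hsq : ((√I)⁻¹) ^ 2 = I⁻¹ := by rw [inv_pow, Real.sq_sqrt hn]
  have ht : TestFun Ω (fun x => (√I)⁻¹ * w x) := by
    refine ⟨contDiff_const.mul h.1, h.2.1.mul_left, ?_⟩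
    exact (closure_mono (Function.support_mul_subset_right _ _)).trans h.2.2
  have hg : ∀ x, gradient (fun x => (√I)⁻¹ * w x) x = (√I)⁻¹ • gradient w x := by
    intro x
    have hdw : DifferentiableAt ℝ w x := (h.1.differentiable (by simp)) x
    simp only [gradient]
    rw [fderiv_const_mul hdw]
    simp
  have hle : lam1 Ω ≤ ∫ x, ‖gradient (fun x => (√I)⁻¹ * w x) x‖ ^ 2 := by
    apply csInf_le
    · refine ⟨0, ?_⟩
      rintro t ⟨v, -, -, rfl⟩
      exact integral_nonneg fun x => by positivity
    · refine ⟨_, test_memH10 ht, ?_, rfl⟩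
      simp_rw [mul_pow]
      rw [integral_const_mul, hsq, ← hI, inv_mul_cancel₀ h0.ne']
  simp_rw [hg, norm_smul, mul_pow] at hle
  rw [integral_const_mul, norm_inv, Real.norm_of_nonneg (Real.sqrt_nonneg _), hsq] at hle
  calc lam1 Ω * I ≤ (I⁻¹ * ∫ x, ‖gradient w x‖ ^ 2) * I := by gcongr
    _ = _ := by field_simp

lemma aux_lim {A B C : ℝ} (h : ∀ ε : ℝ, 0 < ε → ε ≤ 1 → A ≤ B + ε * C) : A ≤ B := by
  have ht : Tendsto (fun ε : ℝ => B + ε * C) (𝓝[>] 0) (𝓝 (B + 0 * C)) :=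
    (Continuous.tendsto (by fun_prop) 0).mono_left nhdsWithin_le_nhds
  rw [zero_mul, add_zero] at ht
  refine ge_of_tendsto ht ?_
  filter_upwards [Ioc_mem_nhdsGT (zero_lt_one' ℝ)] with ε hε using h ε hε.1 hε.2

lemma key1 {Ω D : Set (Euc d)} {ψ φ : Euc d → ℝ} (h : TestFun Ω ψ) (hφ : TestFun D φ)
    (hp : ∀ x, 0 ≤ φ x) (t : ℝ) (ht : 0 ≤ t) :
    lam1 Ω * ∫ x, (max (ψ x - t * φ x) 0) ^ 2 ≤ ∫ x, ‖gradient ψ x - t • gradient φ x‖ ^ 2 := by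
  have hlam := lam1_nonneg Ω
  have hsc : Continuous (fun x => max (ψ x - t * φ x) 0) :=
    (h.1.continuous.sub (continuous_const.mul hφ.1.continuous)).max continuous_const
  have hss : HasCompactSupport (fun x => max (ψ x - t * φ x) 0) := by
    apply h.2.1.mono
    intro x hx hx0
    apply hx
    have := mul_nonneg ht (hp x)
    simp only [hx0]
    exact max_eq_right (by linarith)
  have hsi : Integrable (fun x => max (ψ x - t * φ x) 0) := hsc.integrable_of_hasCompactSupport hss
  have hs2 : Integrable (fun x => (max (ψ x - t * φ x) 0) ^ 2) :=
    (hsc.memLp_of_hasCompactSupport hss (p := 2)).integrable_sq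
  have hgi : MemLp (fun x => gradient ψ x - t • gradient φ x) 2 volume :=
    (grad_memLp h).sub ((grad_memLp hφ).const_smul t)
  have hgi2 := hgi.integrable_norm_pow (by simp)
  have main : ∀ ε : ℝ, 0 < ε → lam1 Ω * ∫ x, (max (ψ x - t * φ x) 0) ^ 2 ≤
      (∫ x, ‖gradient ψ x - t • gradient φ x‖ ^ 2)
        + ε * (2 * lam1 Ω * ∫ x, max (ψ x - t * φ x) 0) := by
    intro ε hε
    obtain ⟨g, g1, g2, g3, g4⟩ := aux_smooth ε hε
    have hw : TestFun Ω (fun x => g (ψ x - t * φ x)) := by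
      have hsub : Function.support (fun x => g (ψ x - t * φ x)) ⊆ Function.support ψ := by
        intro x hx hx0
        apply hx
        have := mul_nonneg ht (hp x)
        simp only [hx0]
        exact g2 _ (by linarith)
      exact ⟨g1.comp (h.1.sub (contDiff_const.mul hφ.1)), h.2.1.mono hsub,
        (closure_mono hsub).trans h.2.2⟩
    have hA := lam1_le hw
    have hB : ∫ x, ‖gradient (fun x => g (ψ x - t * φ x)) x‖ ^ 2 ≤
        ∫ x, ‖gradient ψ x - t • gradient φ x‖ ^ 2 := by
      apply integral_mono_of_nonneg (ae_of_all _ fun x => by positivity) hgi2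
      refine ae_of_all _ fun x => ?_
      have d1 : DifferentiableAt ℝ ψ x := (h.1.differentiable (by simp)) x
      have d2 : DifferentiableAt ℝ φ x := (hφ.1.differentiable (by simp)) x
      have d3 : DifferentiableAt ℝ g (ψ x - t * φ x) := (g1.differentiable (by simp)) _
      have hd : HasFDerivAt (fun x => g (ψ x - t * φ x))
          (deriv g (ψ x - t * φ x) • (fderiv ℝ ψ x - t • fderiv ℝ φ x)) x :=
        d3.hasDerivAt.comp_hasFDerivAt x
          (d1.hasFDerivAt.sub (d2.hasFDerivAt.const_mul t))
      have e : gradient ψ x - t • gradient φ x =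
          (InnerProductSpace.toDual ℝ (Euc d)).symm (fderiv ℝ ψ x - t • fderiv ℝ φ x) := by
        simp [gradient]
      simp only
      rw [norm_grad, hd.fderiv, e, LinearIsometryEquiv.norm_map, norm_smul]
      have := g3 (ψ x - t * φ x)
      rw [← Real.norm_eq_abs] at this
      gcongr
      exact mul_le_of_le_one_left (norm_nonneg _) this
    have hC : ∫ x, (max (ψ x - t * φ x) 0) ^ 2 ≤
        (∫ x, (g (ψ x - t * φ x)) ^ 2) + 2 * ε * ∫ x, max (ψ x - t * φ x) 0 := by
      rw [← integral_const_mul, ← integral_add (test_memLp hw).integrable_sq (hsi.const_mul _)]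
      exact integral_mono hs2 ((test_memLp hw).integrable_sq.add (hsi.const_mul _))
        fun x => g4 _
    nlinarith [mul_le_mul_of_nonneg_left hC hlam]
  exact aux_lim fun ε h0 _ => main ε h0

lemma young (δ a b : ℝ) (hδ : 0 < δ) :
    (a + b) ^ 2 ≤ (1 + δ) * a ^ 2 + (1 + δ⁻¹) * b ^ 2 := by
  have : (1 + δ) * a ^ 2 + (1 + δ⁻¹) * b ^ 2 - (a + b) ^ 2 = δ⁻¹ * (δ * a - b) ^ 2 := by
    field_simp
    ring
  have h2 : 0 ≤ δ⁻¹ * (δ * a - b) ^ 2 := by positivity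
  linarith

/-- For an optimal shape `Ω*`, the distribution `Δu_{Ω*} + λ₁(Ω*) u_{Ω*}` is
nonnegative in `D` (a positive Radon measure): tested against any nonnegative smooth function
compactly supported in `D`, `-∫ ⟪∇u, ∇φ⟫ + λ₁(Ω*) ∫ u φ ≥ 0`. -/
theorem laplacian_plus_eigenvalue_nonneg
    {d : ℕ} (D : Set (Euc d)) (a : ℝ) (Ωstar : Set (Euc d)) (u : Euc d → ℝ)
    (hD : IsOpen D) (hDb : Bornology.IsBounded D)
    (ha : 0 < a) (ha' : a < mvol D)
    (hopt : IsOptimalShape D a Ωstar)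
    (hu : IsFirstEigenfun Ωstar u) (hnn : ∀ x, 0 ≤ u x) :
    ∀ φ : Euc d → ℝ, TestFun D φ → (∀ x, 0 ≤ φ x) →
      (∫ x, ⟪gradient u x, gradient φ x⟫) ≤ lam1 Ωstar * ∫ x, u x * φ x := by
  intro φ hφ hp
  obtain ⟨⟨hu2, hgu, ψ, hψ, hlim⟩, hn1, hn2, -⟩ := hu
  set lam := lam1 Ωstar with hlamdef
  have hlam : 0 ≤ lam := lam1_nonneg Ωstar
  have hφ2 := test_memLp hφ
  have hgφ := grad_memLp hφ
  have huφ : Integrable (fun x => u x * φ x) := hu2.integrable_mul hφ2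
  have hgg : Integrable (fun x => ⟪gradient u x, gradient φ x⟫) := by
    have := L2.integrable_inner (𝕜 := ℝ) hgu.toLp hgφ.toLp
    refine this.congr ?_
    filter_upwards [hgu.coeFn_toLp, hgφ.coeFn_toLp] with x h1 h2
    rw [h1, h2]
  have hu2i : Integrable (fun x => u x ^ 2) := hu2.integrable_sq
  have hgu2 : Integrable (fun x => ‖gradient u x‖ ^ 2) := hgu.integrable_norm_pow (by simp)
  have hgφ2 : Integrable (fun x => ‖gradient φ x‖ ^ 2) := hgφ.integrable_norm_pow (by simp)
  have main : ∀ t : ℝ, 0 < t → lam * (∫ x, (u x ^ 2 - 2 * t * (u x * φ x))) ≤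
      ∫ x, ‖gradient u x - t • gradient φ x‖ ^ 2 := by
    intro t ht
    have hBi : Integrable (fun x => ‖gradient u x - t • gradient φ x‖ ^ 2) :=
      (hgu.sub (hgφ.const_smul t)).integrable_norm_pow (by simp)
    have hAi : Integrable (fun x => u x ^ 2 - 2 * t * (u x * φ x)) :=
      hu2i.sub (huφ.const_mul _)
    set B := ∫ x, ‖gradient u x - t • gradient φ x‖ ^ 2 with hB
    have hB0 : 0 ≤ B := integral_nonneg fun x => by positivity
    refine aux_lim (C := 3 * B) fun δ hδ hδ1 => ?_
    have step : lam * (∫ x, (u x ^ 2 - 2 * t * (u x * φ x))) ≤ (1 + δ) ^ 2 * B := by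
      have hT := (hlim.const_mul ((1 + δ) * (1 + δ⁻¹) + lam * (1 + δ⁻¹))).const_add
        ((1 + δ) ^ 2 * B)
      rw [mul_zero, add_zero] at hT
      refine ge_of_tendsto' hT fun n => ?_
      have hei : Integrable (fun x => (u x - ψ n x) ^ 2
          + ‖gradient u x - gradient (ψ n) x‖ ^ 2) :=
        (hu2.sub (test_memLp (hψ n))).integrable_sq.add
          ((hgu.sub (grad_memLp (hψ n))).integrable_norm_pow (by simp))
      set e := ∫ x, ((u x - ψ n x) ^ 2 + ‖gradient u x - gradient (ψ n) x‖ ^ 2) with he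
      have hsi : Integrable (fun x => (max (ψ n x - t * φ x) 0) ^ 2) := by
        have : MemLp (fun x => max (ψ n x - t * φ x) 0) 2 (volume : Measure (Euc d)) :=
          ((test_memLp (hψ n)).sub (hφ2.const_mul t)).pos_part
        exact this.integrable_sq
      have k := key1 (hψ n) hφ hp t ht.le
      have i1 : (∫ x, (u x ^ 2 - 2 * t * (u x * φ x))) ≤
          (1 + δ) * (∫ x, (max (ψ n x - t * φ x) 0) ^ 2) + (1 + δ⁻¹) * e := by
        rw [he, ← integral_const_mul, ← integral_const_mul,
          ← integral_add (hsi.const_mul _) (hei.const_mul _)]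
        refine integral_mono hAi ((hsi.const_mul _).add (hei.const_mul _)) fun x => ?_
        have ux := hnn x
        have px := mul_nonneg ht.le (hp x)
        have y := young δ (max (ψ n x - t * φ x) 0) (|u x - ψ n x|) hδ
        rw [sq_abs] at y
        have hd' : 0 < δ⁻¹ := inv_pos.2 hδ
        have z : 0 ≤ (1 + δ⁻¹) * ‖gradient u x - gradient (ψ n) x‖ ^ 2 := by positivity
        have m1 := le_max_left (ψ n x - t * φ x) 0
        have m2 := le_max_right (ψ n x - t * φ x) 0
        have m3 := le_abs_self (u x - ψ n x)
        have m4 := abs_nonneg (u x - ψ n x)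
        have q : u x ^ 2 - 2 * t * (u x * φ x) ≤
            (max (ψ n x - t * φ x) 0 + |u x - ψ n x|) ^ 2 := by
          rcases le_total (u x) (t * φ x) with h | h
          · nlinarith [sq_nonneg (max (ψ n x - t * φ x) 0 + |u x - ψ n x|)]
          · have : u x - t * φ x ≤ max (ψ n x - t * φ x) 0 + |u x - ψ n x| := by linarith
            nlinarith [mul_self_le_mul_self (sub_nonneg.2 h) this, sq_nonneg (t * φ x)]
        simp only
        linarith
      have i2 : (∫ x, ‖gradient (ψ n) x - t • gradient φ x‖ ^ 2) ≤
          (1 + δ) * B + (1 + δ⁻¹) * e := by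
        rw [he, hB, ← integral_const_mul, ← integral_const_mul,
          ← integral_add (hBi.const_mul _) (hei.const_mul _)]
        refine integral_mono
          (((grad_memLp (hψ n)).sub (hgφ.const_smul t)).integrable_norm_pow (by simp))
          ((hBi.const_mul _).add (hei.const_mul _)) fun x => ?_
        have y := young δ ‖gradient u x - t • gradient φ x‖
          ‖gradient u x - gradient (ψ n) x‖ hδ
        have hd' : 0 < δ⁻¹ := inv_pos.2 hδ
        have z : 0 ≤ (1 + δ⁻¹) * (u x - ψ n x) ^ 2 := by positivity
        have tri : ‖gradient (ψ n) x - t • gradient φ x‖ ≤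
            ‖gradient u x - t • gradient φ x‖ + ‖gradient u x - gradient (ψ n) x‖ := by
          have := norm_sub_le (gradient u x - t • gradient φ x)
            (gradient u x - gradient (ψ n) x)
          have e3 : gradient (ψ n) x - t • gradient φ x = (gradient u x - t • gradient φ x) -
            (gradient u x - gradient (ψ n) x) := by abel
          rwa [← e3] at this
        have tri2 := pow_le_pow_left₀ (norm_nonneg _) tri 2
        simp only
        linarith
      have j1 := mul_le_mul_of_nonneg_left i1 hlam
      have j2 := mul_le_mul_of_nonneg_left (k.trans i2) (by linarith : 0 ≤ 1 + δ)
      linarith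
    nlinarith [mul_nonneg hB0 hδ.le, mul_nonneg (mul_nonneg hB0 hδ.le) (sub_nonneg.2 hδ1)]
  refine aux_lim (C := (∫ x, ‖gradient φ x‖ ^ 2) / 2) fun t ht _ => ?_
  have m := main t ht
  have eA : (∫ x, (u x ^ 2 - 2 * t * (u x * φ x))) = 1 - 2 * t * ∫ x, u x * φ x := by
    rw [integral_sub hu2i (huφ.const_mul _), hn1, integral_const_mul]
  have eB : (∫ x, ‖gradient u x - t • gradient φ x‖ ^ 2) =
      lam - 2 * t * (∫ x, ⟪gradient u x, gradient φ x⟫) + t ^ 2 * ∫ x, ‖gradient φ x‖ ^ 2 := by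
    have hs : Integrable (fun x => ‖gradient u x‖ ^ 2 -
        2 * t * ⟪gradient u x, gradient φ x⟫) := hgu2.sub (hgg.const_mul _)
    rw [← hn2, ← integral_const_mul, ← integral_const_mul, ← integral_sub hgu2 (hgg.const_mul _),
      ← integral_add hs (hgφ2.const_mul _)]
    congr 1
    ext x
    rw [norm_sub_sq_real, inner_smul_right, norm_smul, Real.norm_of_nonneg ht.le]
    ring
  rw [eA, eB] at m
  have : t * (∫ x, ⟪gradient u x, gradient φ x⟫) ≤
      t * (lam * (∫ x, u x * φ x) + t * ((∫ x, ‖gradient φ x‖ ^ 2) / 2)) := by nlinarith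
  exact le_of_mul_le_mul_left this ht

end
end

section
/- Let u be a solution of the variational problem: u minimizes J(w) := ∫_D|∇w|² − λ_a∫_D w² among all w ∈ H¹₀(D) with |Ω_w| ≤ a, where D is bounded, open and connected. Then there exists Λ ≥ 0 such that, for all vector fields Φ ∈ C^∞_0(D,R^d), ∫_D 2(DΦ ∇u, ∇u) − ∫_D |∇u|² div Φ + λ_a ∫_D u² div Φ = Λ ∫_{Ω_u} div Φ, where DΦ is the Jacobian matrix of Φ. -/
open MeasureTheory Filter Metric Set
open scoped RealInnerProductSpace ENNReal Topology NNReal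

noncomputable section

variable {d : ℕ}

section GenA

variable {E : Type} [NormedAddCommGroup E] [InnerProductSpace ℝ E] [FiniteDimensional ℝ E]

def gtr (A : E →L[ℝ] E) : ℝ := LinearMap.trace ℝ E (A : E →ₗ[ℝ] E)

abbrev gbas (E : Type) [NormedAddCommGroup E] [InnerProductSpace ℝ E] [FiniteDimensional ℝ E] :
    Module.Basis (Fin (Module.finrank ℝ E)) ℝ E := (stdOrthonormalBasis ℝ E).toBasis

def gmat (B : E →L[ℝ] E) : Matrix (Fin (Module.finrank ℝ E)) (Fin (Module.finrank ℝ E)) ℝ :=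
  LinearMap.toMatrix (gbas E) (gbas E) (B : E →ₗ[ℝ] E)

lemma det_eq_gmat (B : E →L[ℝ] E) : B.det = (gmat B).det := by
  rw [gmat, LinearMap.det_toMatrix]

lemma gmat_apply_contDiff (i j) : ContDiff ℝ 1 (fun B : E →L[ℝ] E => gmat B i j) := by
  let L : (E →L[ℝ] E) →ₗ[ℝ] ℝ :=
    { toFun := fun B => gmat B i j
      map_add' := by intro x y; simp [gmat]
      map_smul' := by intro x y; simp [gmat] }
  exact (LinearMap.toContinuousLinearMap L).contDiff

lemma contDiff_cdet : ContDiff ℝ 1 (fun B : E →L[ℝ] E => B.det) := by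
  have : (fun B : E →L[ℝ] E => B.det) = fun B => (gmat B).det := funext det_eq_gmat
  rw [this]
  simp only [Matrix.det_apply]
  refine ContDiff.sum fun σ _ => ?_
  refine ContDiff.const_smul _ ?_
  exact contDiff_prod fun i _ => gmat_apply_contDiff _ _

lemma hasDerivAt_det (A : E →L[ℝ] E) :
    HasDerivAt (fun t : ℝ => (1 + t • A).det) (gtr A) 0 := by
  have h : ∀ t : ℝ, gmat (1 + t • A) = 1 + t • gmat A := by
    intro t
    have : ((1 + t • A : E →L[ℝ] E) : E →ₗ[ℝ] E) = LinearMap.id + t • (A : E →ₗ[ℝ] E) := rfl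
    rw [gmat, this, map_add, map_smul, LinearMap.toMatrix_id]
    rfl
  have h2 : (fun t : ℝ => (1 + t • A).det) = fun t => 1 + (gmat A).trace * t +
      (Polynomial.eval t (Matrix.det (1 + (Polynomial.X : Polynomial ℝ) • (gmat A).map Polynomial.C)).divX.divX) * t ^ 2 := by
    ext t
    rw [det_eq_gmat, h, Matrix.det_one_add_smul]
  rw [h2]
  have h3 : gtr A = (gmat A).trace := by
    rw [gtr, LinearMap.trace_eq_matrix_trace ℝ (gbas E)]
    rfl
  rw [h3]
  generalize (Matrix.det (1 + (Polynomial.X : Polynomial ℝ) • (gmat A).map Polynomial.C)).divX.divX = p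
  have := (((hasDerivAt_id (0:ℝ)).const_mul (gmat A).trace).const_add 1).add
    ((p.hasDerivAt 0).mul ((hasDerivAt_id (0:ℝ)).pow 2))
  refine (this.congr_deriv ?_)
  simp

/-- gradient kernel -/
def Kg (B : E →L[ℝ] E) : E →L[ℝ] E :=
  (1 + B).det • (Ring.inverse (1 + B) * ContinuousLinearMap.adjoint (Ring.inverse (1 + B)))

/-- scalar kernel -/
def Ks (B : E →L[ℝ] E) : ℝ →L[ℝ] ℝ := (1 + B).det • ContinuousLinearMap.id ℝ ℝ

lemma contDiff_one_add_det : ContDiff ℝ 1 (fun B : E →L[ℝ] E => (1 + B).det) :=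
  contDiff_cdet.comp (contDiff_const.add contDiff_id)

lemma contDiff_Ks : ContDiff ℝ 1 (Ks (E := E)) :=
  contDiff_one_add_det.smul contDiff_const

lemma contDiffAt_oinv : ContDiffAt ℝ 1 (fun B : E →L[ℝ] E => Ring.inverse (1 + B)) 0 := by
  have : CompleteSpace E := FiniteDimensional.complete ℝ E
  have h := contDiffAt_ringInverse ℝ (n := 1) (1 : (E →L[ℝ] E)ˣ)
  have h1 : ContDiffAt ℝ 1 (fun B : E →L[ℝ] E => 1 + B) 0 := contDiffAt_const.add contDiffAt_id
  refine ContDiffAt.comp (0 : E →L[ℝ] E) (g := Ring.inverse) ?_ h1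
  simpa using h

lemma contDiffAt_Kg : ContDiffAt ℝ 1 (Kg (E := E)) 0 := by
  refine contDiff_one_add_det.contDiffAt.smul ?_
  have h : ContDiff ℝ 1 (fun B : E →L[ℝ] E => ContinuousLinearMap.adjoint B) :=
    (ContinuousLinearMap.adjoint (𝕜 := ℝ) (E := E) (F := E)).toContinuousLinearEquiv.contDiff
  exact contDiffAt_oinv.mul (h.contDiffAt.comp (0 : E →L[ℝ] E) contDiffAt_oinv)

lemma hasDerivAt_inv_line (A : E →L[ℝ] E) :
    HasDerivAt (fun t : ℝ => Ring.inverse (1 + t • A)) (-A) 0 := by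
  have : CompleteSpace E := FiniteDimensional.complete ℝ E
  have h := hasFDerivAt_ringInverse (𝕜 := ℝ) (1 : (E →L[ℝ] E)ˣ)
  have h1 : HasDerivAt (fun t : ℝ => (1 : E →L[ℝ] E) + t • A) A 0 := by
    simpa using ((hasDerivAt_id (0:ℝ)).smul_const A).const_add (1 : E →L[ℝ] E)
  have h' : HasFDerivAt (Ring.inverse : (E →L[ℝ] E) → (E →L[ℝ] E))
      (-ContinuousLinearMap.mulLeftRight ℝ (E →L[ℝ] E) ↑(1 : (E →L[ℝ] E)ˣ)⁻¹ ↑(1 : (E →L[ℝ] E)ˣ)⁻¹) (1 + (0:ℝ) • A) := by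
    simpa using h
  have := h'.comp_hasDerivAt (0:ℝ) h1
  refine this.congr_deriv ?_
  simp

lemma hasDerivAt_Ks (A : E →L[ℝ] E) :
    HasDerivAt (fun t : ℝ => Ks (t • A)) (gtr A • ContinuousLinearMap.id ℝ ℝ) 0 :=
  HasDerivAt.smul_const (hasDerivAt_det A) (ContinuousLinearMap.id ℝ ℝ)

lemma hasDerivAt_Kg (A : E →L[ℝ] E) :
    HasDerivAt (fun t : ℝ => Kg (t • A))
      (gtr A • (1 : E →L[ℝ] E) - A - ContinuousLinearMap.adjoint A) 0 := by
  have hi := hasDerivAt_inv_line A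
  have ha : HasDerivAt (fun t : ℝ => ContinuousLinearMap.adjoint (Ring.inverse (1 + t • A)))
      (ContinuousLinearMap.adjoint (-A)) 0 :=
    ((ContinuousLinearMap.adjoint (𝕜 := ℝ) (E := E) (F := E)).toContinuousLinearEquiv.hasFDerivAt).comp_hasDerivAt (0:ℝ) hi
  have := (hasDerivAt_det A).smul (hi.mul ha)
  have h1 : (1 : E →L[ℝ] E).det = 1 := by
    simp [ContinuousLinearMap.det]
  have h2 : ContinuousLinearMap.adjoint (1 : E →L[ℝ] E) = 1 := ContinuousLinearMap.adjoint_id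
  refine this.congr_deriv ?_
  simp [h1, h2]
  abel
end GenA

section GenB

set_option linter.unusedSectionVars false

variable {E : Type} [NormedAddCommGroup E] [InnerProductSpace ℝ E] [FiniteDimensional ℝ E]
  [CompleteSpace E]

structure Dif (D : Set E) (T S : E → E) : Prop where
  left : ∀ x, S (T x) = x
  right : ∀ x, T (S x) = x
  hT : ContDiff ℝ (⊤ : ℕ∞) T
  hS : ContDiff ℝ (⊤ : ℕ∞) S
  bT : ∃ C : ℝ, ∀ x, ‖fderiv ℝ T x‖ ≤ C
  bS : ∃ C : ℝ, ∀ x, ‖fderiv ℝ S x‖ ≤ C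
  mapD : ∀ x, T x ∈ D ↔ x ∈ D

lemma exists_bound_fderiv {Φ : E → E} (h : ContDiff ℝ (⊤ : ℕ∞) Φ) (hc : HasCompactSupport Φ) :
    ∃ M : ℝ, 0 < M ∧ ∀ x, ‖fderiv ℝ Φ x‖ ≤ M := by
  have h1 : Continuous (fderiv ℝ Φ) := h.continuous_fderiv (by simp)
  obtain ⟨C, hC⟩ := h1.bounded_above_of_compact_support (hc.fderiv (𝕜 := ℝ))
  exact ⟨max C 1, by positivity, fun x => (hC x).trans (le_max_left _ _)⟩

lemma isUnit_one_add_of_small (B : E →L[ℝ] E) (h : ‖B‖ < 1) : IsUnit (1 + B) := by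
  have : IsUnit (1 - (-B)) := isUnit_one_sub_of_norm_lt_one (by simpa using h)
  simpa using this

lemma exists_dif {D : Set E} {Φ : E → E} (h : ContDiff ℝ (⊤ : ℕ∞) Φ) (hc : HasCompactSupport Φ)
    (hD : tsupport Φ ⊆ D) :
    ∃ δ : ℝ, 0 < δ ∧ ∀ t : ℝ, |t| < δ → ∃ S : E → E, Dif D (fun x => x + t • Φ x) S ∧
      ∀ y, IsUnit (1 + t • fderiv ℝ Φ y) := by
  obtain ⟨M, hM0, hM⟩ := exists_bound_fderiv h hc
  refine ⟨1 / (2 * M), by positivity, fun t ht => ?_⟩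
  have htM : |t| * M < 1 / 2 := by
    rw [lt_div_iff₀ (by positivity)] at ht
    linarith
  have hdiff : Differentiable ℝ Φ := h.differentiable (by simp)
  have hu : ∀ y, IsUnit (1 + t • fderiv ℝ Φ y) := by
    intro y
    apply isUnit_one_add_of_small
    rw [norm_smul, Real.norm_eq_abs]
    calc |t| * ‖fderiv ℝ Φ y‖ ≤ |t| * M := by gcongr; exact hM y
      _ < 1 := by linarith
  set T : E → E := fun x => x + t • Φ x with hTdef
  have hT : ContDiff ℝ (⊤ : ℕ∞) T := contDiff_id.add (h.const_smul t)
  have hTd : ∀ y, HasFDerivAt T (1 + t • fderiv ℝ Φ y) y := fun y =>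
    (hasFDerivAt_id y).add ((hdiff y).hasFDerivAt.const_smul t)
  have hlip : LipschitzWith (Real.toNNReal (|t| * M)) (fun x => t • Φ x) := by
    refine lipschitzWith_of_nnnorm_fderiv_le (𝕜 := ℝ) (hdiff.const_smul t) fun x => ?_
    rw [← NNReal.coe_le_coe, Real.coe_toNNReal _ (by positivity), coe_nnnorm]
    have : fderiv ℝ (fun x => t • Φ x) x = t • fderiv ℝ Φ x :=
      ((hdiff x).hasFDerivAt.const_smul t).fderiv
    rw [this, norm_smul, Real.norm_eq_abs]
    gcongr
    exact hM x
  have happ : ApproximatesLinearOn T ((ContinuousLinearEquiv.refl ℝ E : E ≃L[ℝ] E) : E →L[ℝ] E) univ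
      (Real.toNNReal (|t| * M)) := by
    intro x _ y _
    have := hlip.dist_le_mul x y
    rw [dist_eq_norm, dist_eq_norm] at this
    have e1 : T x - T y - ((ContinuousLinearEquiv.refl ℝ E : E ≃L[ℝ] E) : E →L[ℝ] E) (x - y) =
        t • Φ x - t • Φ y := by
      change (x + t • Φ x) - (y + t • Φ y) - (x - y) = _
      abel
    rw [e1]
    exact this
  have hcond : Subsingleton E ∨ Real.toNNReal (|t| * M) <
      ‖((ContinuousLinearEquiv.refl ℝ E).symm : E →L[ℝ] E)‖₊⁻¹ := by
    rcases subsingleton_or_nontrivial E with hE | hE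
    · exact Or.inl hE
    · right
      have : ‖((ContinuousLinearEquiv.refl ℝ E).symm : E →L[ℝ] E)‖₊ = 1 := by
        have := ContinuousLinearMap.norm_id (𝕜 := ℝ) (E := E)
        ext
        simpa using this
      rw [this, inv_one, Real.toNNReal_lt_one]
      linarith
  let e : E ≃ₜ E := happ.toHomeomorph T hcond
  have he : ∀ x, e x = T x := fun x => rfl
  have hS : ContDiff ℝ (⊤ : ℕ∞) e.symm := by
    refine e.contDiff_symm (f₀' := fun a => ContinuousLinearEquiv.unitsEquiv ℝ E (hu a).unit) ?_ hT
    intro a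
    exact hTd a
  have hr : ∀ x, T (e.symm x) = x := fun x => e.apply_symm_apply x
  have hl : ∀ x, e.symm (T x) = x := fun x => e.symm_apply_apply x
  have hfix : ∀ x, x ∉ D → T x = x := by
    intro x hx
    have : Φ x = 0 := image_eq_zero_of_notMem_tsupport fun h' => hx (hD h')
    simp [hTdef, this]
  refine ⟨e.symm, ⟨hl, hr, hT, hS, ?_, ?_, ?_⟩, hu⟩
  · refine ⟨‖(1 : E →L[ℝ] E)‖ + 1 / 2, fun x => ?_⟩
    rw [(hTd x).fderiv]
    refine (norm_add_le _ _).trans ?_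
    rw [norm_smul, Real.norm_eq_abs]
    have : |t| * ‖fderiv ℝ Φ x‖ ≤ |t| * M := by gcongr; exact hM x
    linarith
  · set G : E → E := fun x => e.symm x - x
    have hG : ContDiff ℝ (⊤ : ℕ∞) G := hS.sub contDiff_id
    have hGc : HasCompactSupport G := by
      refine HasCompactSupport.intro (K := T '' tsupport Φ) (IsCompact.image hc hT.continuous) ?_
      intro x hx
      have : Φ (e.symm x) = 0 := image_eq_zero_of_notMem_tsupport fun h' => hx ⟨_, h', hr x⟩
      have h2 := hr x
      simp only [hTdef, this, smul_zero, add_zero] at h2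
      simp [G, h2]
    obtain ⟨C, _, hC⟩ := exists_bound_fderiv hG hGc
    refine ⟨C + ‖(1 : E →L[ℝ] E)‖, fun x => ?_⟩
    have : HasFDerivAt (e.symm : E → E) (fderiv ℝ G x + 1) x := by
      have := ((hG.differentiable (by simp)) x).hasFDerivAt.add (hasFDerivAt_id x)
      refine this.congr_of_eventuallyEq (Eventually.of_forall fun y => ?_)
      simp [G]
    rw [this.fderiv]
    refine (norm_add_le _ _).trans ?_
    gcongr
    exact hC x
  · intro x
    constructor
    · intro hx
      by_contra hx'
      rw [hfix x hx'] at hx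
      exact hx' hx
    · intro hx
      by_contra hx'
      have h1 := hfix _ hx'
      have h2 : T x = x := e.injective h1
      rw [h2] at hx'
      exact hx' hx

variable {D : Set E} {T S : E → E}

lemma Dif.hasT (h : Dif D T S) (x : E) : HasFDerivAt T (fderiv ℝ T x) x :=
  ((h.hT.differentiable (by simp)) x).hasFDerivAt

lemma Dif.hasS (h : Dif D T S) (x : E) : HasFDerivAt S (fderiv ℝ S x) x :=
  ((h.hS.differentiable (by simp)) x).hasFDerivAt

lemma Dif.ST (h : Dif D T S) (y : E) : fderiv ℝ S (T y) * fderiv ℝ T y = 1 := by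
  have h1 := (h.hasS (T y)).comp y (h.hasT y)
  have h2 : S ∘ T = id := funext h.left
  rw [h2] at h1
  exact h1.unique (hasFDerivAt_id y)

lemma Dif.TS (h : Dif D T S) (y : E) : fderiv ℝ T y * fderiv ℝ S (T y) = 1 := by
  have h1 := (h.hasT (S (T y))).comp (T y) (h.hasS (T y))
  have h2 : T ∘ S = id := funext h.right
  rw [h2, h.left] at h1
  exact h1.unique (hasFDerivAt_id (T y))

lemma Dif.inv_eq (h : Dif D T S) (y : E) : fderiv ℝ S (T y) = Ring.inverse (fderiv ℝ T y) := by
  let U : (E →L[ℝ] E)ˣ := ⟨fderiv ℝ T y, fderiv ℝ S (T y), h.TS y, h.ST y⟩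
  exact (Ring.inverse_unit U).symm

lemma Dif.symm (h : Dif D T S) : Dif D S T :=
  ⟨h.right, h.left, h.hS, h.hT, h.bS, h.bT, fun x => by
    have := h.mapD (S x)
    rw [h.right] at this
    exact this.symm⟩

lemma gradient_inner (v : E → ℝ) (x w : E) : ⟪gradient v x, w⟫ = fderiv ℝ v x w := by
  rw [gradient, InnerProductSpace.toDual_symm_apply]

lemma Dif.gradient_comp (h : Dif D T S) (v : E → ℝ) (x : E) :
    gradient (fun x => v (S x)) x =
      ContinuousLinearMap.adjoint (fderiv ℝ S x) (gradient v (S x)) := by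
  refine ext_inner_right ℝ fun w => ?_
  rw [gradient_inner, ContinuousLinearMap.adjoint_inner_left, gradient_inner]
  by_cases hv : DifferentiableAt ℝ v (S x)
  · have := (hv.hasFDerivAt.comp x (h.hasS x)).fderiv
    have h2 : (fun x => v (S x)) = v ∘ S := rfl
    rw [h2, this]
    rfl
  · have : ¬ DifferentiableAt ℝ (fun x => v (S x)) x := by
      intro h'
      apply hv
      have h3 : DifferentiableAt ℝ (fun x => v (S x)) (T (S x)) := by rwa [h.right]
      have h4 := h3.comp (S x) (h.hasT (S x)).differentiableAt
      have h5 : (fun x => v (S x)) ∘ T = v := by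
        ext z; simp [h.left]
      rwa [h5] at h4
    rw [fderiv_zero_of_not_differentiableAt hv, fderiv_zero_of_not_differentiableAt this]
    simp
end GenB

section GenC

set_option linter.unusedSectionVars false

variable {E : Type} [NormedAddCommGroup E] [InnerProductSpace ℝ E] [FiniteDimensional ℝ E]
  [CompleteSpace E] [MeasureSpace E] [BorelSpace E] [(volume : Measure E).IsAddHaarMeasure]

variable {D : Set E} {T S : E → E}

lemma Dif.inj (h : Dif D T S) : Function.Injective T :=
  Function.LeftInverse.injective h.left

lemma Dif.preimage (h : Dif D T S) (s : Set E) : S ⁻¹' s = T '' s := by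
  ext x
  constructor
  · intro hx
    exact ⟨S x, hx, h.right x⟩
  · rintro ⟨y, hy, rfl⟩
    simpa [h.left] using hy

lemma Dif.map_le (h : Dif D T S) :
    ∃ C : ℝ≥0, Measure.map S (volume : Measure E) ≤ (C : ℝ≥0∞) • (volume : Measure E) := by
  obtain ⟨C, hC⟩ := h.bT
  obtain ⟨M, hM⟩ := (isCompact_closedBall (0 : E →L[ℝ] E) C).exists_bound_of_continuousOn
    (f := fun B : E →L[ℝ] E => B.det) ContinuousLinearMap.continuous_det.continuousOn
  refine ⟨M.toNNReal, ?_⟩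
  refine Measure.le_iff.2 fun s hs => ?_
  rw [Measure.map_apply h.hS.continuous.measurable hs, h.preimage,
    ← lintegral_abs_det_fderiv_eq_addHaar_image volume hs
      (fun x _ => (h.hasT x).hasFDerivWithinAt) h.inj.injOn]
  calc ∫⁻ x in s, ENNReal.ofReal |(fderiv ℝ T x).det| ≤ ∫⁻ x in s, (M.toNNReal : ℝ≥0∞) := by
        refine lintegral_mono fun x => ?_
        refine ENNReal.ofReal_le_ofReal ?_
        exact hM _ (by simpa using hC x)
    _ = _ := by simp

lemma Dif.memLp_comp {F : Type} [NormedAddCommGroup F] (h : Dif D T S) {f : E → F}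
    (hf : MemLp f 2 (volume : Measure E)) : MemLp (fun x => f (S x)) 2 (volume : Measure E) := by
  obtain ⟨C, hC⟩ := h.map_le
  exact (hf.of_measure_le_smul (by simp) hC).comp_of_map h.hS.continuous.aemeasurable

lemma Dif.integral_comp_le (h : Dif D T S) :
    ∃ C : ℝ, 0 ≤ C ∧ ∀ f : E → ℝ, (∀ x, 0 ≤ f x) → Integrable f →
      Integrable (fun x => f (S x)) ∧ ∫ x, f (S x) ≤ C * ∫ x, f x := by
  obtain ⟨C, hC⟩ := h.map_le
  refine ⟨C, C.2, fun f hf hi => ?_⟩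
  have h1 : Integrable f (Measure.map S volume) := hi.of_measure_le_smul (by simp) hC
  have hS : AEMeasurable S (volume : Measure E) := h.hS.continuous.aemeasurable
  refine ⟨h1.comp_aemeasurable hS, ?_⟩
  rw [← integral_map hS h1.1]
  have h2 : Integrable f ((C : ℝ≥0∞) • (volume : Measure E)) := hi.smul_measure (by simp)
  refine (integral_mono_measure hC (Eventually.of_forall hf) h2).trans ?_
  rw [integral_smul_measure]
  simp

def gTest (Ω : Set E) (φ : E → ℝ) : Prop :=
  ContDiff ℝ (⊤ : ℕ∞) φ ∧ HasCompactSupport φ ∧ tsupport φ ⊆ Ω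

def gMem (Ω : Set E) (v : E → ℝ) : Prop :=
  MemLp v 2 (volume : Measure E) ∧
  MemLp (fun x => gradient v x) 2 (volume : Measure E) ∧
  ∃ φ : ℕ → E → ℝ, (∀ n, gTest Ω (φ n)) ∧
    Tendsto (fun n => ∫ x, ((v x - φ n x) ^ 2 + ‖gradient v x - gradient (φ n) x‖ ^ 2))
      atTop (nhds 0)

lemma gradient_continuous {φ : E → ℝ} (h : ContDiff ℝ (⊤ : ℕ∞) φ) :
    Continuous (fun x => gradient φ x) := by
  unfold gradient
  exact (LinearIsometryEquiv.continuous _).comp (h.continuous_fderiv (by simp))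

lemma gTest.memLp {Ω : Set E} {φ : E → ℝ} (h : gTest Ω φ) :
    MemLp φ 2 (volume : Measure E) ∧ MemLp (fun x => gradient φ x) 2 (volume : Measure E) := by
  refine ⟨h.1.continuous.memLp_of_hasCompactSupport h.2.1,
    (gradient_continuous h.1).memLp_of_hasCompactSupport ?_⟩
  refine HasCompactSupport.comp_left (g := (InnerProductSpace.toDual ℝ E).symm) (h.2.1.fderiv (𝕜 := ℝ)) (by simp)

lemma Dif.gTest_comp (h : Dif D T S) {φ : E → ℝ} (hφ : gTest D φ) :
    gTest D (fun x => φ (S x)) := by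
  have hK : IsCompact (T '' tsupport φ) := IsCompact.image hφ.2.1 h.hT.continuous
  have h0 : ∀ x, x ∉ T '' tsupport φ → φ (S x) = 0 := by
    intro x hx
    exact image_eq_zero_of_notMem_tsupport fun h' => hx ⟨_, h', h.right x⟩
  refine ⟨hφ.1.comp h.hS, HasCompactSupport.intro hK h0, ?_⟩
  have h1 : tsupport (fun x => φ (S x)) ⊆ T '' tsupport φ := by
    refine closure_minimal ?_ hK.isClosed
    intro x hx
    by_contra hx'
    exact hx (h0 x hx')
  refine h1.trans ?_
  rintro _ ⟨y, hy, rfl⟩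
  exact (h.mapD y).2 (hφ.2.2 hy)

lemma Dif.memLp_adj (h : Dif D T S) {g : E → E} (hg : MemLp g 2 (volume : Measure E)) :
    MemLp (fun x => ContinuousLinearMap.adjoint (fderiv ℝ S x) (g (S x))) 2
      (volume : Measure E) := by
  obtain ⟨C, hC⟩ := h.bS
  have h1 := h.memLp_comp hg
  have hcont : Continuous (fun x => ContinuousLinearMap.adjoint (fderiv ℝ S x)) :=
    (ContinuousLinearMap.adjoint (𝕜 := ℝ) (E := E) (F := E)).continuous.comp
      (h.hS.continuous_fderiv (by simp))
  refine h1.of_le_mul (c := C) ?_ (Eventually.of_forall fun x => ?_)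
  · exact isBoundedBilinearMap_apply.continuous.comp_aestronglyMeasurable
      (hcont.aestronglyMeasurable.prodMk h1.1)
  · refine (ContinuousLinearMap.le_opNorm _ _).trans ?_
    rw [LinearIsometryEquiv.norm_map]
    gcongr
    exact hC x

lemma Dif.gMem_comp (h : Dif D T S) {v : E → ℝ} (hv : gMem D v) :
    gMem D (fun x => v (S x)) := by
  obtain ⟨h1, h2, φ, hφ, hlim⟩ := hv
  refine ⟨h.memLp_comp h1, ?_, fun n x => φ n (S x), fun n => h.gTest_comp (hφ n), ?_⟩
  · simp only [h.gradient_comp]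
    exact h.memLp_adj h2
  · simp only [h.gradient_comp, ← map_sub]
    obtain ⟨C, hC0, hC⟩ := h.integral_comp_le
    obtain ⟨M, hM⟩ := h.bS
    have hM0 : 0 ≤ M := (norm_nonneg _).trans (hM 0)
    let f : ℕ → E → ℝ := fun n x => (v x - φ n x) ^ 2 + ‖gradient v x - gradient (φ n) x‖ ^ 2
    have hfi : ∀ n, Integrable (f n) := by
      intro n
      have a1 := (h1.sub (hφ n).memLp.1).integrable_norm_pow (p := 2) (by simp)
      have a2 := (h2.sub (hφ n).memLp.2).integrable_norm_pow (p := 2) (by simp)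
      have := a1.add a2
      refine this.congr (Eventually.of_forall fun x => ?_)
      simp [f]
    have hf0 : ∀ n x, 0 ≤ f n x := fun n x => by positivity
    have hup : Tendsto (fun n => (1 + M ^ 2) * (C * ∫ x, f n x)) atTop (nhds 0) := by
      have := (hlim.const_mul C).const_mul (1 + M ^ 2)
      simpa using this
    refine squeeze_zero (fun n => integral_nonneg fun x => by positivity) (fun n => ?_) hup
    obtain ⟨i1, i2⟩ := hC (f n) (hf0 n) (hfi n)
    calc _ ≤ ∫ x, (1 + M ^ 2) * f n (S x) := by
          refine integral_mono_of_nonneg (Eventually.of_forall fun x => by positivity)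
            (i1.const_mul _) (Eventually.of_forall fun x => ?_)
          have b1 : ‖ContinuousLinearMap.adjoint (fderiv ℝ S x)
              (gradient v (S x) - gradient (φ n) (S x))‖ ≤
              M * ‖gradient v (S x) - gradient (φ n) (S x)‖ := by
            refine (ContinuousLinearMap.le_opNorm _ _).trans ?_
            rw [LinearIsometryEquiv.norm_map]
            gcongr
            exact hM x
          have b2 := pow_le_pow_left₀ (norm_nonneg _) b1 2
          rw [mul_pow] at b2
          simp only [f]
          nlinarith [sq_nonneg (v (S x) - φ n (S x)), sq_nonneg M,
            mul_nonneg (sq_nonneg M) (sq_nonneg (v (S x) - φ n (S x))),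
            sq_nonneg ‖gradient v (S x) - gradient (φ n) (S x)‖]
      _ = (1 + M ^ 2) * ∫ x, f n (S x) := integral_const_mul _ _
      _ ≤ _ := by gcongr

/-- change of variables -/
lemma Dif.integral_eq (h : Dif D T S) (f : E → ℝ) :
    ∫ x, f x = ∫ y, |(fderiv ℝ T y).det| * f (T y) := by
  have := integral_image_eq_integral_abs_det_fderiv_smul (volume : Measure E) MeasurableSet.univ
    (fun x _ => (h.hasT x).hasFDerivWithinAt) h.inj.injOn f
  have hr : T '' univ = univ := by rw [← h.preimage]; rfl
  simpa [hr] using this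

def gOm (D : Set E) (v : E → ℝ) : Set E := {x ∈ D | v x ≠ 0}

lemma Dif.gOm_comp (h : Dif D T S) (v : E → ℝ) :
    gOm D (fun x => v (S x)) = T '' gOm D v := by
  rw [← h.preimage]
  ext x
  have := h.symm.mapD x
  simp only [gOm, mem_ofPred_eq, mem_preimage, this]

lemma Dif.vol_le (h : Dif D T S) (hb : Bornology.IsBounded D) {s : Set E} (hs : s ⊆ D) :
    (volume (T '' s)).toReal ≤ ∫ y in s, |(fderiv ℝ T y).det| := by
  have hfin : volume s ≠ ∞ := ((measure_mono hs).trans_lt hb.measure_lt_top).ne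
  set M := toMeasurable volume s
  have hcont : Continuous (fun y => |(fderiv ℝ T y).det|) :=
    (ContinuousLinearMap.continuous_det.comp (h.hT.continuous_fderiv (by simp))).abs
  have h1 : volume (T '' s) ≤ ∫⁻ y in s, ENNReal.ofReal |(fderiv ℝ T y).det| := by
    refine (measure_mono (image_mono (subset_toMeasurable volume s))).trans ?_
    rw [← lintegral_abs_det_fderiv_eq_addHaar_image volume (measurableSet_toMeasurable volume s)
      (fun x _ => (h.hasT x).hasFDerivWithinAt) h.inj.injOn, Measure.restrict_toMeasurable hfin]
  have hint : IntegrableOn (fun y => |(fderiv ℝ T y).det|) s := by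
    refine IntegrableOn.mono_set ?_ (hs.trans subset_closure)
    exact hcont.continuousOn.integrableOn_compact hb.isCompact_closure
  rw [integral_eq_lintegral_of_nonneg_ae (Eventually.of_forall fun y => abs_nonneg _) hint.1]
  refine ENNReal.toReal_mono ?_ h1
  rw [← ofReal_integral_eq_lintegral_ofReal hint (Eventually.of_forall fun y => abs_nonneg _)]
  simp
end GenC

section GenD

set_option linter.unusedSectionVars false

variable {E : Type} [NormedAddCommGroup E] [InnerProductSpace ℝ E] [FiniteDimensional ℝ E]
  [CompleteSpace E] [MeasureSpace E] [BorelSpace E] [(volume : Measure E).IsAddHaarMeasure]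

lemma aesm_quad {H : Type} [NormedAddCommGroup H] [InnerProductSpace ℝ H] {μ : Measure E}
    {B : E → (H →L[ℝ] H)} (hB : Continuous B) {g : E → H} (hg : AEStronglyMeasurable g μ)
    [SecondCountableTopologyEither E (H →L[ℝ] H)] :
    AEStronglyMeasurable (fun y => ⟪B y (g y), g y⟫) μ := by
  have h1 : AEStronglyMeasurable (fun y => B y (g y)) μ :=
    isBoundedBilinearMap_apply.continuous.comp_aestronglyMeasurable
      (hB.aestronglyMeasurable.prodMk hg)
  exact h1.inner hg

lemma abs_quad_le {H : Type} [NormedAddCommGroup H] [InnerProductSpace ℝ H]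
    (B : H →L[ℝ] H) (g : H) : |⟪B g, g⟫| ≤ ‖B‖ * ‖g‖ ^ 2 := by
  refine (abs_real_inner_le_norm _ _).trans ?_
  have := B.le_opNorm g
  nlinarith [norm_nonneg g]

lemma integrable_quad {H : Type} [NormedAddCommGroup H] [InnerProductSpace ℝ H] {μ : Measure E}
    {B : E → (H →L[ℝ] H)} (hB : Continuous B) {C : ℝ} (hC : ∀ y, ‖B y‖ ≤ C) {g : E → H}
    (hg : MemLp g 2 μ) : Integrable (fun y => ⟪B y (g y), g y⟫) μ := by
  have a2 := hg.integrable_norm_pow (p := 2) (by simp)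
  refine (a2.const_mul C).mono' (aesm_quad hB hg.1) (Eventually.of_forall fun y => ?_)
  refine (abs_quad_le _ _).trans ?_
  gcongr
  exact hC y

lemma param_deriv {H : Type} [NormedAddCommGroup H] [InnerProductSpace ℝ H] {μ : Measure E}
    {K : (E →L[ℝ] E) → (H →L[ℝ] H)} (hK : ContDiffAt ℝ 1 K 0)
    {A : E → (E →L[ℝ] E)} (hA : Continuous A) {M : ℝ} (hM0 : 0 < M) (hM : ∀ y, ‖A y‖ ≤ M)
    {g : E → H} (hg : MemLp g 2 μ)
    {K' : E → (H →L[ℝ] H)} (hK' : Continuous K')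
    (hd : ∀ y, HasDerivAt (fun t : ℝ => K (t • A y)) (K' y) 0) :
    HasDerivAt (fun t : ℝ => ∫ y, ⟪K (t • A y) (g y), g y⟫ ∂μ)
      (∫ y, ⟪K' y (g y), g y⟫ ∂μ) 0 := by
  obtain ⟨C, s, hs, hL⟩ := hK.exists_lipschitzOnWith
  obtain ⟨r, hr, hrs⟩ := Metric.mem_nhds_iff.1 hs
  have hin : ∀ t ∈ ball (0:ℝ) (r / M), ∀ y, t • A y ∈ s := by
    intro t ht y
    apply hrs
    rw [mem_ball_zero_iff] at ht ⊢
    rw [norm_smul]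
    rw [lt_div_iff₀ hM0] at ht
    refine lt_of_le_of_lt ?_ ht
    gcongr
    exact hM y
  have hball : ball (0:ℝ) (r / M) ∈ 𝓝 (0:ℝ) := ball_mem_nhds _ (by positivity)
  have hcont : ∀ t ∈ ball (0:ℝ) (r / M), Continuous (fun y => K (t • A y)) := by
    intro t ht
    exact hL.continuousOn.comp_continuous (hA.const_smul t) (hin t ht)
  have a2 := hg.integrable_norm_pow (p := 2) (by simp)
  refine (hasDerivAt_integral_of_dominated_loc_of_lip (bound := fun y => C * M * ‖g y‖ ^ 2)
    (s := ball (0:ℝ) (r / M)) hball ?_ ?_ ?_ ?_ ?_ ?_).2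
  · filter_upwards [hball] with t ht
    exact aesm_quad (hcont t ht) hg.1
  · have : ∀ y, ‖K ((0:ℝ) • A y)‖ ≤ ‖K 0‖ := fun y => by simp
    exact integrable_quad (hcont 0 (mem_ball_self (by positivity))) this hg
  · exact aesm_quad hK' hg.1
  · refine Eventually.of_forall fun y => ?_
    refine LipschitzOnWith.of_dist_le_mul fun t ht t' ht' => ?_
    have h1 := hL.dist_le_mul _ (hin t ht y) _ (hin t' ht' y)
    rw [dist_eq_norm, dist_eq_norm, ← sub_smul, norm_smul] at h1
    rw [Real.dist_eq, ← inner_sub_left, ← sub_apply, Real.dist_eq]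
    refine (abs_quad_le _ _).trans ?_
    have hb : 0 ≤ (C:ℝ) * M * ‖g y‖ ^ 2 := by positivity
    rw [Real.coe_nnabs, abs_of_nonneg hb]
    have h2 : (C:ℝ) * (‖t - t'‖ * ‖A y‖) ≤ C * (‖t - t'‖ * M) := by
      gcongr
      exact hM y
    rw [Real.norm_eq_abs] at h1 h2
    calc _ ≤ (C * (|t - t'| * M)) * ‖g y‖ ^ 2 := by
          gcongr
          exact h1.trans h2
      _ = _ := by ring
  · exact a2.const_mul _
  · refine Eventually.of_forall fun y => ?_
    have := ((hd y).clm_apply (hasDerivAt_const (0:ℝ) (g y))).inner ℝ (hasDerivAt_const (0:ℝ) (g y))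
    simpa using this

lemma gtr_continuous : Continuous (gtr (E := E)) := by
  let L : (E →L[ℝ] E) →ₗ[ℝ] ℝ :=
    { toFun := gtr
      map_add' := by intro x y; simp [gtr]
      map_smul' := by intro x y; simp [gtr] }
  exact L.continuous_of_finiteDimensional

lemma gtr_add (A B : E →L[ℝ] E) : gtr (A + B) = gtr A + gtr B := by simp [gtr]
lemma gtr_smul (c : ℝ) (A : E →L[ℝ] E) : gtr (c • A) = c * gtr A := by simp [gtr]

def gJ (lam : ℝ) (v : E → ℝ) : ℝ :=
  (∫ x, ‖gradient v x‖ ^ 2) - lam * ∫ x, (v x) ^ 2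

def gL (lam : ℝ) (u : E → ℝ) (Φ : E → E) : ℝ :=
  (∫ x, 2 * ⟪(fderiv ℝ Φ x) (gradient u x), gradient u x⟫)
        - (∫ x, ‖gradient u x‖ ^ 2 * gtr (fderiv ℝ Φ x))
        + lam * (∫ x, (u x) ^ 2 * gtr (fderiv ℝ Φ x))

def gV (s : Set E) (Φ : E → E) : ℝ := ∫ x in s, gtr (fderiv ℝ Φ x)

def gVec (Ω : Set E) (Φ : E → E) : Prop :=
  ContDiff ℝ (⊤ : ℕ∞) Φ ∧ HasCompactSupport Φ ∧ tsupport Φ ⊆ Ω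

lemma gVec.cont {Ω : Set E} {Φ : E → E} (h : gVec Ω Φ) : Continuous (fderiv ℝ Φ) :=
  h.1.continuous_fderiv (by simp)

lemma gVec.cont_tr {Ω : Set E} {Φ : E → E} (h : gVec Ω Φ) :
    Continuous (fun x => gtr (fderiv ℝ Φ x)) := gtr_continuous.comp h.cont

lemma gVec.bound_tr {Ω : Set E} {Φ : E → E} (h : gVec Ω Φ) :
    ∃ C, ∀ x, |gtr (fderiv ℝ Φ x)| ≤ C := by
  have : HasCompactSupport (fun x => gtr (fderiv ℝ Φ x)) :=
    (h.2.1.fderiv (𝕜 := ℝ)).comp_left (g := gtr) (by simp [gtr])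
  exact h.cont_tr.bounded_above_of_compact_support this

lemma gVec.int1 {Ω : Set E} {Φ : E → E} (h : gVec Ω Φ) {g : E → E} (hg : MemLp g 2 volume) :
    Integrable (fun x => ⟪(fderiv ℝ Φ x) (g x), g x⟫) := by
  obtain ⟨M, _, hM⟩ := exists_bound_fderiv h.1 h.2.1
  exact integrable_quad h.cont hM hg

lemma gVec.int2 {Ω : Set E} {Φ : E → E} (h : gVec Ω Φ) {H : Type} [NormedAddCommGroup H]
    {g : E → H} (hg : MemLp g 2 volume) :
    Integrable (fun x => ‖g x‖ ^ 2 * gtr (fderiv ℝ Φ x)) := by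
  obtain ⟨M, hM⟩ := h.bound_tr
  have a2 := hg.integrable_norm_pow (p := 2) (by simp)
  exact a2.mul_bdd h.cont_tr.aestronglyMeasurable (Eventually.of_forall hM)

lemma gVec.int3 {Ω : Set E} {Φ : E → E} (h : gVec Ω Φ) {s : Set E} :
    IntegrableOn (fun x => gtr (fderiv ℝ Φ x)) s := by
  have : HasCompactSupport (fun x => gtr (fderiv ℝ Φ x)) :=
    (h.2.1.fderiv (𝕜 := ℝ)).comp_left (g := gtr) (by simp [gtr])
  exact (h.cont_tr.integrable_of_hasCompactSupport this).integrableOn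

lemma gVec.comb {Ω : Set E} {Φ Ψ : E → E} (h : gVec Ω Φ) (h' : gVec Ω Ψ) (c : ℝ) :
    gVec Ω (fun x => Φ x + c • Ψ x) := by
  have hs : HasCompactSupport (fun x => c • Ψ x) := h'.2.1.comp_left (g := fun z => c • z) (by simp)
  refine ⟨h.1.add (h'.1.const_smul c), h.2.1.add hs, ?_⟩
  refine (tsupport_add _ _).trans (union_subset h.2.2 (subset_trans ?_ h'.2.2))
  exact closure_mono (Function.support_const_smul_subset c Ψ)

lemma gVec.fderiv_comb {Ω : Set E} {Φ Ψ : E → E} (h : gVec Ω Φ) (h' : gVec Ω Ψ) (c : ℝ) (x : E) :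
    fderiv ℝ (fun x => Φ x + c • Ψ x) x = fderiv ℝ Φ x + c • fderiv ℝ Ψ x :=
  ((h.1.differentiable (by simp) x).hasFDerivAt.add
    ((h'.1.differentiable (by simp) x).hasFDerivAt.const_smul c)).fderiv

lemma gVec.gV_comb {Ω s : Set E} {Φ Ψ : E → E} (h : gVec Ω Φ) (h' : gVec Ω Ψ) (c : ℝ) :
    gV s (fun x => Φ x + c • Ψ x) = gV s Φ + c * gV s Ψ := by
  simp only [gV, h.fderiv_comb h', gtr_add, gtr_smul]
  rw [integral_add h.int3 (h'.int3.const_mul c), integral_const_mul]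

lemma gVec.gL_comb {Ω : Set E} {Φ Ψ : E → E} (h : gVec Ω Φ) (h' : gVec Ω Ψ) (c lam : ℝ) {u : E → ℝ}
    (hu : MemLp u 2 volume) (hg : MemLp (fun x => gradient u x) 2 volume) :
    gL lam u (fun x => Φ x + c • Ψ x) = gL lam u Φ + c * gL lam u Ψ := by
  have e1 : (∫ x, 2 * ⟪(fderiv ℝ (fun x => Φ x + c • Ψ x) x) (gradient u x), gradient u x⟫) =
      (∫ x, 2 * ⟪(fderiv ℝ Φ x) (gradient u x), gradient u x⟫) +
      c * (∫ x, 2 * ⟪(fderiv ℝ Ψ x) (gradient u x), gradient u x⟫) := by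
    rw [← integral_const_mul, ← integral_add ((h.int1 hg).const_mul 2)
      (((h'.int1 hg).const_mul 2).const_mul c)]
    refine integral_congr_ae (Eventually.of_forall fun x => ?_)
    simp only [h.fderiv_comb h', add_apply, smul_apply,
      inner_add_left, real_inner_smul_left]
    ring
  have e2 : (∫ x, ‖gradient u x‖ ^ 2 * gtr (fderiv ℝ (fun x => Φ x + c • Ψ x) x)) =
      (∫ x, ‖gradient u x‖ ^ 2 * gtr (fderiv ℝ Φ x)) +
      c * (∫ x, ‖gradient u x‖ ^ 2 * gtr (fderiv ℝ Ψ x)) := by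
    rw [← integral_const_mul, ← integral_add (h.int2 hg) ((h'.int2 hg).const_mul c)]
    refine integral_congr_ae (Eventually.of_forall fun x => ?_)
    simp only [h.fderiv_comb h', gtr_add, gtr_smul]
    ring
  have e3 : (∫ x, (u x) ^ 2 * gtr (fderiv ℝ (fun x => Φ x + c • Ψ x) x)) =
      (∫ x, (u x) ^ 2 * gtr (fderiv ℝ Φ x)) +
      c * (∫ x, (u x) ^ 2 * gtr (fderiv ℝ Ψ x)) := by
    have i1 := h.int2 hu
    have i2 := h'.int2 hu
    simp only [Real.norm_eq_abs, sq_abs] at i1 i2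
    rw [← integral_const_mul, ← integral_add i1 (i2.const_mul c)]
    refine integral_congr_ae (Eventually.of_forall fun x => ?_)
    simp only [h.fderiv_comb h', gtr_add, gtr_smul]
    ring
  unfold gL
  rw [e1, e2, e3]
  ring
end GenD

section GenE

set_option linter.unusedSectionVars false

variable {E : Type} [NormedAddCommGroup E] [InnerProductSpace ℝ E] [FiniteDimensional ℝ E]
  [CompleteSpace E] [MeasureSpace E] [BorelSpace E] [(volume : Measure E).IsAddHaarMeasure]

lemma det_pos_near : ∃ ρ : ℝ, 0 < ρ ∧ ∀ B : E →L[ℝ] E, ‖B‖ < ρ → 0 < (1 + B).det := by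
  have hc : Continuous (fun B : E →L[ℝ] E => (1 + B).det) := contDiff_one_add_det.continuous
  have h1 : (1 + (0 : E →L[ℝ] E)).det = 1 := by simp [ContinuousLinearMap.det]
  have : ∀ᶠ B in 𝓝 (0 : E →L[ℝ] E), 0 < (1 + B).det := by
    refine hc.continuousAt.eventually_const_lt ?_
    change 0 < (1 + (0 : E →L[ℝ] E)).det
    rw [h1]; exact one_pos
  obtain ⟨ρ, hρ, h⟩ := Metric.eventually_nhds_iff.1 this
  exact ⟨ρ, hρ, fun B hB => h (by simpa using hB)⟩

lemma real_quad (c x : ℝ) : ⟪(c • ContinuousLinearMap.id ℝ ℝ) x, x⟫ = c * x ^ 2 := by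
  simp
  ring

lemma variation {D : Set E} (hb : Bornology.IsBounded D) {u : E → ℝ} (hu : gMem D u) (lam : ℝ)
    {Φ : E → E} (hΦ : gVec D Φ) :
    ∃ j v : ℝ → ℝ, HasDerivAt j (-gL lam u Φ) 0 ∧ HasDerivAt v (gV (gOm D u) Φ) 0 ∧
      j 0 = gJ lam u ∧ v 0 = (volume (gOm D u)).toReal ∧
      ∀ᶠ t in 𝓝 (0:ℝ), ∃ w, gMem D w ∧ (volume (gOm D w)).toReal ≤ v t ∧ gJ lam w = j t := by
  obtain ⟨M, hM0, hM⟩ := exists_bound_fderiv hΦ.1 hΦ.2.1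
  set A : E → (E →L[ℝ] E) := fderiv ℝ Φ with hA
  have hAc : Continuous A := hΦ.cont
  set g : E → E := fun x => gradient u x with hg
  set O := gOm D u with hO
  have hOfin : volume O ≠ ∞ :=
    ((measure_mono (fun x hx => hx.1)).trans_lt hb.measure_lt_top).ne
  have hadj : Continuous (fun y => ContinuousLinearMap.adjoint (A y)) :=
    (ContinuousLinearMap.adjoint (𝕜 := ℝ) (E := E) (F := E)).continuous.comp hAc
  have htr : Continuous (fun y => gtr (A y)) := hΦ.cont_tr
  have d1 := param_deriv (μ := volume)
    (K' := fun y => gtr (A y) • (1 : E →L[ℝ] E) - A y - ContinuousLinearMap.adjoint (A y))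
    contDiffAt_Kg hAc hM0 hM hu.2.1
    (((htr.smul continuous_const).sub hAc).sub hadj) (fun y => hasDerivAt_Kg (A y))
  have d2 := param_deriv (μ := volume)
    (K' := fun y => gtr (A y) • ContinuousLinearMap.id ℝ ℝ)
    contDiff_Ks.contDiffAt hAc hM0 hM hu.1
    (htr.smul continuous_const) (fun y => hasDerivAt_Ks (A y))
  have : IsFiniteMeasure (volume.restrict O) := ⟨by simpa using hOfin.lt_top⟩
  have d3 := param_deriv (μ := volume.restrict O) (g := fun _ => (1:ℝ))
    (K' := fun y => gtr (A y) • ContinuousLinearMap.id ℝ ℝ)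
    contDiff_Ks.contDiffAt hAc
    hM0 hM (memLp_const 1) (htr.smul continuous_const) (fun y => hasDerivAt_Ks (A y))
  have hdet1 : (1 : E →L[ℝ] E).det = 1 := by simp [ContinuousLinearMap.det]
  have hKs0 : Ks (0 : E →L[ℝ] E) = ContinuousLinearMap.id ℝ ℝ := by
    simp [Ks, hdet1]
  have hKg0 : Kg (0 : E →L[ℝ] E) = 1 := by
    have h2 : ContinuousLinearMap.adjoint (1 : E →L[ℝ] E) = 1 := ContinuousLinearMap.adjoint_id
    simp [Kg, hdet1, h2]
  have i1 : Integrable (fun x => ‖g x‖ ^ 2 * gtr (A x)) := hΦ.int2 hu.2.1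
  have i2 : Integrable (fun x => ⟪A x (g x), g x⟫) := hΦ.int1 hu.2.1
  refine ⟨_, _, (d1.sub (d2.const_mul lam)).congr_deriv ?_, d3.congr_deriv ?_, ?_, ?_, ?_⟩
  · have e1 : (∫ y, ⟪(gtr (A y) • (1 : E →L[ℝ] E) - A y -
        ContinuousLinearMap.adjoint (A y)) (gradient u y), gradient u y⟫) =
        (∫ x, ‖g x‖ ^ 2 * gtr (A x)) - ∫ x, 2 * ⟪A x (g x), g x⟫ := by
      rw [← integral_sub i1 (i2.const_mul 2)]
      refine integral_congr_ae (Eventually.of_forall fun y => ?_)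
      have a1 : ⟪ContinuousLinearMap.adjoint (A y) (g y), g y⟫ = ⟪A y (g y), g y⟫ := by
        rw [ContinuousLinearMap.adjoint_inner_left, real_inner_comm]
      have a2 : ⟪(gtr (A y) • g y), g y⟫ = ‖g y‖ ^ 2 * gtr (A y) := by
        rw [real_inner_smul_left, real_inner_self_eq_norm_sq, mul_comm]
      change ⟪gtr (A y) • g y - A y (g y) - ContinuousLinearMap.adjoint (A y) (g y), g y⟫ = _
      rw [inner_sub_left, inner_sub_left, a1, a2]
      ring
    have e2 : (∫ y, ⟪(gtr (A y) • ContinuousLinearMap.id ℝ ℝ) (u y), u y⟫)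
        = ∫ x, (u x) ^ 2 * gtr (A x) := by
      refine integral_congr_ae (Eventually.of_forall fun y => ?_)
      change ⟪(gtr (A y) • ContinuousLinearMap.id ℝ ℝ) (u y), u y⟫ = _
      rw [real_quad, mul_comm]
    rw [e1, e2]
    unfold gL
    ring
  · refine integral_congr_ae (Eventually.of_forall fun y => ?_)
    change ⟪(gtr (A y) • ContinuousLinearMap.id ℝ ℝ) 1, 1⟫ = _
    rw [real_quad]
    simp [hA]
  · simp only [zero_smul, hKs0, hKg0, gJ, Pi.sub_apply]
    congr 2
    · ext y
      exact real_inner_self_eq_norm_sq _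
    · refine integral_congr_ae (Eventually.of_forall fun y => ?_)
      simp
  · simp only [zero_smul, hKs0]
    simp [Measure.real]
  · obtain ⟨ρ, hρ, hdet⟩ := det_pos_near (E := E)
    obtain ⟨δ, hδ, hS⟩ := exists_dif hΦ.1 hΦ.2.1 hΦ.2.2
    have hb1 : ball (0:ℝ) (min δ (ρ / M)) ∈ 𝓝 (0:ℝ) := ball_mem_nhds _ (by positivity)
    filter_upwards [hb1] with t ht
    rw [mem_ball_zero_iff, Real.norm_eq_abs, lt_min_iff] at ht
    obtain ⟨S, hd, -⟩ := hS t ht.1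
    have hTd : ∀ y, fderiv ℝ (fun x => x + t • Φ x) y = 1 + t • A y := fun y =>
      ((hasFDerivAt_id y).add
        (((hΦ.1.differentiable (by simp)) y).hasFDerivAt.const_smul t)).fderiv
    have hpos : ∀ y, 0 < (1 + t • A y).det := by
      intro y
      apply hdet
      rw [norm_smul, Real.norm_eq_abs]
      have := ht.2
      rw [lt_div_iff₀ hM0] at this
      refine lt_of_le_of_lt ?_ this
      gcongr
      exact hM y
    refine ⟨fun x => u (S x), hd.gMem_comp hu, ?_, ?_⟩
    · rw [hd.gOm_comp]
      refine (hd.vol_le hb (fun x hx => hx.1)).trans (le_of_eq ?_)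
      refine integral_congr_ae (Eventually.of_forall fun y => ?_)
      simp only [hTd, Ks]
      rw [real_quad, abs_of_pos (hpos y)]
      simp
    · simp only [gJ, Pi.sub_apply]
      congr 1
      · rw [hd.integral_eq]
        refine integral_congr_ae (Eventually.of_forall fun y => ?_)
        simp only [hd.gradient_comp]
        rw [hd.inv_eq, hTd, hd.left, abs_of_pos (hpos y)]
        simp only [Kg]
        change _ = ⟪(1 + t • A y).det • (Ring.inverse (1 + t • A y)
          (ContinuousLinearMap.adjoint (Ring.inverse (1 + t • A y)) (g y))), g y⟫
        rw [real_inner_smul_left, ← ContinuousLinearMap.adjoint_inner_right,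
          real_inner_self_eq_norm_sq]
      · congr 1
        rw [hd.integral_eq]
        refine integral_congr_ae (Eventually.of_forall fun y => ?_)
        simp only [hTd, Ks, hd.left]
        rw [real_quad, abs_of_pos (hpos y)]

lemma first_variation {D : Set E} (hb : Bornology.IsBounded D) {u : E → ℝ} (hu : gMem D u)
    {lam a : ℝ} (hle : (volume (gOm D u)).toReal ≤ a)
    (hmin : ∀ w, gMem D w → (volume (gOm D w)).toReal ≤ a → gJ lam u ≤ gJ lam w)
    {Φ : E → E} (hΦ : gVec D Φ)
    (h : gV (gOm D u) Φ < 0 ∨ (volume (gOm D u)).toReal < a) : gL lam u Φ ≤ 0 := by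
  obtain ⟨j, v, hj, hv, hj0, hv0, hev⟩ := variation hb hu lam hΦ
  have hva : ∀ᶠ t in 𝓝[>] (0:ℝ), v t ≤ a := by
    rcases h with h | h
    · have := hv.tendsto_slope_zero_right
      have h2 := this.eventually_lt_const h
      filter_upwards [h2, self_mem_nhdsWithin] with t ht ht0
      have ht0' : (0:ℝ) < t := ht0
      simp only [zero_add, smul_eq_mul] at ht
      have : v t - v 0 < 0 := by
        by_contra hcon
        push Not at hcon
        have : 0 ≤ t⁻¹ * (v t - v 0) := by positivity
        linarith
      rw [hv0] at this
      linarith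
    · have h2 : ∀ᶠ t in 𝓝 (0:ℝ), v t < a :=
        hv.continuousAt.eventually_lt_const (by rw [hv0]; exact h)
      exact (h2.filter_mono nhdsWithin_le_nhds).mono fun t ht => ht.le
  have hge : ∀ᶠ t in 𝓝[>] (0:ℝ), 0 ≤ t⁻¹ • (j (0 + t) - j 0) := by
    filter_upwards [hva, hev.filter_mono nhdsWithin_le_nhds, self_mem_nhdsWithin] with t h1 h2 h3
    obtain ⟨w, hw, hw1, hw2⟩ := h2
    have := hmin w hw (hw1.trans h1)
    have h3' : (0:ℝ) < t := h3
    rw [zero_add, smul_eq_mul, hj0, ← hw2]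
    have : 0 ≤ gJ lam w - gJ lam u := by linarith
    positivity
  have := ge_of_tendsto hj.tendsto_slope_zero_right hge
  linarith

lemma multiplier {D : Set E} (hb : Bornology.IsBounded D) {u : E → ℝ} (hu : gMem D u)
    {lam a : ℝ} (hle : (volume (gOm D u)).toReal ≤ a)
    (hmin : ∀ w, gMem D w → (volume (gOm D w)).toReal ≤ a → gJ lam u ≤ gJ lam w)
    (hex : (volume (gOm D u)).toReal = a → ∃ Φ, gVec D Φ ∧ gV (gOm D u) Φ ≠ 0) :
    ∃ Λ : ℝ, 0 ≤ Λ ∧ ∀ Φ : E → E, gVec D Φ → gL lam u Φ = Λ * gV (gOm D u) Φ := by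
  have key : ∀ {Φ : E → E}, gVec D Φ → _ → _ := fun hΦ => first_variation hb hu hle hmin hΦ
  have Lc : ∀ {Φ Ψ : E → E} (c : ℝ), gVec D Φ → gVec D Ψ →
      gL lam u (fun x => Φ x + c • Ψ x) = gL lam u Φ + c * gL lam u Ψ :=
    fun c h h' => h.gL_comb h' c lam hu.1 hu.2.1
  have Vc : ∀ {Φ Ψ : E → E} (c : ℝ), gVec D Φ → gVec D Ψ →
      gV (gOm D u) (fun x => Φ x + c • Ψ x) = gV (gOm D u) Φ + c * gV (gOm D u) Ψ :=
    fun c h h' => h.gV_comb h' c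
  rcases hle.lt_or_eq with hlt | heq
  · refine ⟨0, le_rfl, fun Φ hΦ => ?_⟩
    have h1 := key hΦ (Or.inr hlt)
    have h2 := key (hΦ.comb hΦ (-2)) (Or.inr hlt)
    rw [Lc _ hΦ hΦ] at h2
    linarith
  · have hex' : ∃ Φ, gVec D Φ ∧ gV (gOm D u) Φ < 0 := by
      obtain ⟨Φ, hΦ, hne⟩ := hex heq
      rcases lt_or_gt_of_ne hne with h | h
      · exact ⟨Φ, hΦ, h⟩
      · refine ⟨_, hΦ.comb hΦ (-2), ?_⟩
        rw [Vc _ hΦ hΦ]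
        linarith
    obtain ⟨Φ₀, h0, hV0⟩ := hex'
    have hL0 := key h0 (Or.inl hV0)
    have zero : ∀ Ψ, gVec D Ψ → gV (gOm D u) Ψ = 0 → gL lam u Ψ ≤ 0 := by
      intro Ψ hΨ hz
      by_contra hcon
      push Not at hcon
      have hp : 0 < 2 * (1 - gL lam u Φ₀) := by linarith
      have he : 0 < gL lam u Ψ / (2 * (1 - gL lam u Φ₀)) := by positivity
      have h1 := key (hΨ.comb h0 (gL lam u Ψ / (2 * (1 - gL lam u Φ₀)))) (Or.inl (by
        rw [Vc _ hΨ h0, hz, zero_add]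
        exact mul_neg_of_pos_of_neg he hV0))
      rw [Lc _ hΨ h0] at h1
      have h2 : gL lam u Ψ / (2 * (1 - gL lam u Φ₀)) * (2 * (1 - gL lam u Φ₀)) = gL lam u Ψ :=
        div_mul_cancel₀ _ hp.ne'
      nlinarith
    refine ⟨gL lam u Φ₀ / gV (gOm D u) Φ₀, div_nonneg_of_nonpos hL0 hV0.le, fun Φ hΦ => ?_⟩
    set c := -(gV (gOm D u) Φ / gV (gOm D u) Φ₀) with hc
    have hΨ := hΦ.comb h0 c
    have hz : gV (gOm D u) (fun x => Φ x + c • Φ₀ x) = 0 := by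
      rw [Vc _ hΦ h0, hc, neg_mul, div_mul_cancel₀ _ hV0.ne]
      ring
    have z1 := zero _ hΨ hz
    have z2 := zero _ (hΨ.comb hΨ (-2)) (by rw [Vc _ hΨ hΨ, hz]; ring)
    rw [Lc _ hΨ hΨ] at z2
    have z3 : gL lam u (fun x => Φ x + c • Φ₀ x) = 0 := by linarith
    rw [Lc _ hΦ h0, hc] at z3
    have : gL lam u Φ = gV (gOm D u) Φ / gV (gOm D u) Φ₀ * gL lam u Φ₀ := by linarith
    rw [this]
    ring
end GenE

section GenF

set_option linter.unusedSectionVars false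

variable {E : Type} [NormedAddCommGroup E] [InnerProductSpace ℝ E] [FiniteDimensional ℝ E]
  [CompleteSpace E] [MeasureSpace E] [BorelSpace E] [(volume : Measure E).IsAddHaarMeasure]

lemma gtr_smulRight (l : E →L[ℝ] ℝ) (e : E) : gtr (l.smulRight e) = l e := by
  have : ((l.smulRight e : E →L[ℝ] E) : E →ₗ[ℝ] E) = (l : E →ₗ[ℝ] ℝ).smulRight e := rfl
  rw [gtr, this, LinearMap.trace_smulRight]
  rfl

lemma conv_fderiv_zero {D s : Set E} (hs : NullMeasurableSet s volume)
    (hV : ∀ Φ, gVec D Φ → gV s Φ = 0) {φ : E → ℝ} (hφ : ContDiff ℝ (⊤ : ℕ∞) φ)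
    (hφc : HasCompactSupport φ) {r : ℝ} (hφr : tsupport φ ⊆ closedBall 0 r) {x : E}
    (hx : closedBall x r ⊆ D) :
    HasFDerivAt (convolution φ (s.indicator (fun _ => (1:ℝ))) (ContinuousLinearMap.lsmul ℝ ℝ) volume)
      (0 : E →L[ℝ] ℝ) x := by
  have hloc : LocallyIntegrable (s.indicator (fun _ => (1:ℝ))) (volume : Measure E) := by
    intro z
    refine ⟨closedBall z 1, closedBall_mem_nhds z one_pos, ?_⟩
    refine Integrable.indicator₀ ?_ (hs.mono_ac Measure.restrict_le_self.absolutelyContinuous)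
    exact integrableOn_const (measure_closedBall_lt_top.ne)
  have h1 := hφc.hasFDerivAt_convolution_left (ContinuousLinearMap.lsmul ℝ ℝ) (hφ.of_le (by simp))
    hloc x (μ := (volume : Measure E))
  refine h1.congr_fderiv ?_
  ext e
  have hint := ((hφc.fderiv (𝕜 := ℝ)).convolutionExists_left
    ((ContinuousLinearMap.lsmul ℝ ℝ : ℝ →L[ℝ] ℝ →L[ℝ] ℝ).precompL E) (hφ.continuous_fderiv (by simp))
    hloc x)
  rw [convolution, ContinuousLinearMap.integral_apply hint]
  simp only [ContinuousLinearMap.precompL_apply, ContinuousLinearMap.lsmul_apply, smul_eq_mul,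
    zero_apply]
  rw [← integral_sub_left_eq_self _ _ x]
  simp only [sub_sub_cancel]
  set ψ : E → ℝ := fun y => φ (x - y) with hψ
  have hψs : ContDiff ℝ (⊤ : ℕ∞) ψ := hφ.comp (contDiff_const.sub contDiff_id)
  have h0 : ∀ y, y ∉ closedBall x r → ψ y = 0 := by
    intro y hy
    change φ (x - y) = 0
    refine image_eq_zero_of_notMem_tsupport fun h' => hy ?_
    have := hφr h'
    rw [mem_closedBall_zero_iff] at this
    rwa [mem_closedBall, dist_comm, dist_eq_norm]
  have hfd : ∀ y, HasFDerivAt (fun y => ψ y • e) ((-(fderiv ℝ φ (x - y))).smulRight e) y := by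
    intro y
    have a1 : HasFDerivAt (fun y : E => x - y) (-1 : E →L[ℝ] E) y := (hasFDerivAt_id y).const_sub x
    have a2 := ((hφ.differentiable (by simp) (x - y)).hasFDerivAt).comp y a1
    have a3 : HasFDerivAt ψ (-(fderiv ℝ φ (x - y))) y := by
      refine a2.congr_fderiv ?_
      ext w
      simp
    exact a3.smul_const e
  have hvec : gVec D (fun y => ψ y • e) := by
    have hsup : tsupport (fun y => ψ y • e) ⊆ closedBall x r := by
      refine closure_minimal ?_ isClosed_closedBall
      intro y hy
      by_contra hy'
      apply hy
      simp [h0 y hy']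
    refine ⟨hψs.smul contDiff_const, ?_, hsup.trans hx⟩
    exact (isCompact_closedBall x r).of_isClosed_subset (isClosed_tsupport _) hsup
  have := hV _ hvec
  rw [gV] at this
  simp only [(hfd _).fderiv, gtr_smulRight, neg_apply, integral_neg, neg_eq_zero] at this
  rw [← this, ← integral_indicator₀ hs]
  refine integral_congr_ae (Eventually.of_forall fun y => ?_)
  by_cases hy : y ∈ s <;> simp [hy]

lemma locally_const {D s : Set E} (hD : IsOpen D) (hs : NullMeasurableSet s volume)
    (hV : ∀ Φ, gVec D Φ → gV s Φ = 0) {x : E} (hx : x ∈ D) :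
    (∃ r > 0, ∀ᵐ y, y ∈ ball x r → y ∈ s) ∨ (∃ r > 0, ∀ᵐ y, y ∈ ball x r → y ∉ s) := by
  obtain ⟨R, hR, hRD⟩ := Metric.isOpen_iff.1 hD x hx
  set r := R / 2 with hr
  have hr0 : 0 < r := by positivity
  set f := s.indicator (fun _ => (1:ℝ)) with hf
  have hloc : LocallyIntegrable f (volume : Measure E) := by
    intro z
    refine ⟨closedBall z 1, closedBall_mem_nhds z one_pos, ?_⟩
    refine Integrable.indicator₀ ?_ (hs.mono_ac Measure.restrict_le_self.absolutelyContinuous)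
    exact integrableOn_const (measure_closedBall_lt_top.ne)
  let φ : ℕ → ContDiffBump (0 : E) := fun n =>
    ⟨r / (4 * (n + 1)), r / (2 * (n + 1)), by positivity, by
      apply div_lt_div_of_pos_left hr0 (by positivity)
      have : (0:ℝ) < n + 1 := by positivity
      linarith⟩
  have hlim : Tendsto (fun n => (φ n).rOut) atTop (𝓝 0) := by
    have := (tendsto_one_div_add_atTop_nhds_zero_nat (𝕜 := ℝ)).const_mul (r / 2)
    rw [mul_zero] at this
    refine this.congr fun n => ?_
    simp only [φ]
    field_simp
  have hae := ContDiffBump.ae_convolution_tendsto_right_of_locallyIntegrable (K := 2) hlim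
    (Eventually.of_forall fun n => by
      simp only [φ]
      apply le_of_eq
      field_simp
      norm_num) hloc
  have hconst : ∀ n, ∀ y ∈ ball x r, ∀ z ∈ ball x r,
      (convolution ((φ n).normed volume) f (ContinuousLinearMap.lsmul ℝ ℝ) volume) y =
      (convolution ((φ n).normed volume) f (ContinuousLinearMap.lsmul ℝ ℝ) volume) z := by
    intro n y hy z hz
    have hd : ∀ w ∈ ball x r, HasFDerivAt
        (convolution ((φ n).normed volume) f (ContinuousLinearMap.lsmul ℝ ℝ) volume)
        (0 : E →L[ℝ] ℝ) w := by
      intro w hw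
      refine conv_fderiv_zero (D := D) (r := (φ n).rOut) hs hV (φ n).contDiff_normed
        (φ n).hasCompactSupport_normed ?_ ?_
      · rw [(φ n).tsupport_normed_eq]
      · intro q hq
        apply hRD
        rw [mem_closedBall] at hq
        rw [mem_ball] at hw ⊢
        have h1 : (φ n).rOut ≤ r / 2 := by
          simp only [φ]
          apply div_le_div_of_nonneg_left hr0.le (by norm_num)
          have : (0:ℝ) ≤ n := by positivity
          linarith
        have := dist_triangle q w x
        linarith
    refine (convex_ball x r).is_const_of_fderivWithin_eq_zero (𝕜 := ℝ)
      (fun w hw => (hd w hw).differentiableAt.differentiableWithinAt) (fun w hw => ?_) hy hz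
    rw [fderivWithin_of_isOpen isOpen_ball hw, (hd w hw).fderiv]
  obtain ⟨y0, hy0, hlim0⟩ : ∃ y0 ∈ ball x r, Tendsto (fun n =>
      (convolution ((φ n).normed volume) f (ContinuousLinearMap.lsmul ℝ ℝ) volume) y0) atTop
      (𝓝 (f y0)) := by
    by_contra hcon
    push Not at hcon
    have hpos : 0 < volume (ball x r) := measure_ball_pos volume x hr0
    refine hpos.ne' (measure_mono_null ?_ hae)
    intro y hy
    exact hcon y hy
  have hall : ∀ᵐ y, y ∈ ball x r → f y = f y0 := by
    filter_upwards [hae] with y hy hyb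
    refine tendsto_nhds_unique hy (hlim0.congr fun n => ?_)
    exact hconst n y0 hy0 y hyb
  by_cases h0 : y0 ∈ s
  · left
    refine ⟨r, hr0, ?_⟩
    filter_upwards [hall] with y hy hyb
    by_contra hys
    have := hy hyb
    simp [hf, h0, hys] at this
  · right
    refine ⟨r, hr0, ?_⟩
    filter_upwards [hall] with y hy hyb hys
    have := hy hyb
    simp [hf, h0, hys] at this

lemma isOpen_aeball (p : E → Prop) : IsOpen {x : E | ∃ r > 0, ∀ᵐ y, y ∈ ball x r → p y} := by
  rw [Metric.isOpen_iff]
  rintro x ⟨r, hr, h⟩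
  refine ⟨r / 2, by positivity, fun z hz => ⟨r / 2, by positivity, ?_⟩⟩
  filter_upwards [h] with y hy hyz
  apply hy
  rw [mem_ball] at *
  have := dist_triangle y z x
  linarith

lemma null_of_aeball {D : Set E} {p : E → Prop} (h : D ⊆ {x : E | ∃ r > 0, ∀ᵐ y, y ∈ ball x r → p y}) :
    volume {x ∈ D | ¬ p x} = 0 := by
  refine measure_null_of_locally_null _ fun x hx => ?_
  obtain ⟨r, hr, hae⟩ := h hx.1
  refine ⟨{y ∈ ball x r | ¬ p y}, ?_, ?_⟩
  · refine mem_nhdsWithin.2 ⟨ball x r, isOpen_ball, mem_ball_self hr, ?_⟩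
    rintro y ⟨hy1, hy2⟩
    exact ⟨hy1, hy2.2⟩
  · refine measure_mono_null ?_ hae
    rintro y ⟨hy1, hy2⟩ hcon
    exact hy2 (hcon hy1)

lemma trivial_of_gV {D s : Set E} (hD : IsOpen D) (hc : IsPreconnected D)
    (hs : NullMeasurableSet s volume) (hsD : s ⊆ D) (hV : ∀ Φ, gVec D Φ → gV s Φ = 0) :
    volume s = 0 ∨ volume (D \ s) = 0 := by
  set U1 := {x : E | ∃ r > 0, ∀ᵐ y, y ∈ ball x r → y ∈ s}
  set U0 := {x : E | ∃ r > 0, ∀ᵐ y, y ∈ ball x r → y ∉ s}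
  have hcov : D ⊆ U1 ∪ U0 := fun x hx => locally_const hD hs hV hx
  have hdisj : U1 ∩ U0 = ∅ := by
    ext x
    simp only [mem_inter_iff, mem_empty_iff_false, iff_false, not_and]
    rintro ⟨r, hr, h1⟩ ⟨r', hr', h2⟩
    have hpos : 0 < volume (ball x (min r r')) := measure_ball_pos volume x (by positivity)
    refine hpos.ne' (measure_mono_null ?_ (h1.and h2))
    intro y hy hcon
    exact hcon.2 (ball_subset_ball (min_le_right _ _) hy)
      (hcon.1 (ball_subset_ball (min_le_left _ _) hy))
  by_cases hn1 : (D ∩ U1).Nonempty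
  · by_cases hn0 : (D ∩ U0).Nonempty
    · obtain ⟨x, _, hx⟩ := hc U1 U0 (isOpen_aeball _) (isOpen_aeball _) hcov hn1 hn0
      rw [hdisj] at hx
      exact hx.elim
    · right
      have : D ⊆ U1 := fun x hx => (hcov hx).resolve_right fun h => hn0 ⟨x, hx, h⟩
      exact null_of_aeball this
  · left
    have : D ⊆ U0 := fun x hx => (hcov hx).resolve_left fun h => hn1 ⟨x, hx, h⟩
    refine measure_mono_null ?_ (null_of_aeball this)
    intro x hx
    exact ⟨hsD hx, fun h => h hx⟩

theorem gmain {D : Set E} {a lam : ℝ} {u : E → ℝ} (hD : IsOpen D) (hb : Bornology.IsBounded D)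
    (hc : IsPreconnected D) (ha : 0 < a) (ha' : a < (volume D).toReal) (hu : gMem D u)
    (hle : (volume (gOm D u)).toReal ≤ a)
    (hmin : ∀ w, gMem D w → (volume (gOm D w)).toReal ≤ a → gJ lam u ≤ gJ lam w) :
    ∃ Λ : ℝ, 0 ≤ Λ ∧ ∀ Φ : E → E, gVec D Φ → gL lam u Φ = Λ * gV (gOm D u) Φ := by
  refine multiplier hb hu hle hmin fun heq => ?_
  by_contra hcon
  push Not at hcon
  have hs : NullMeasurableSet (gOm D u) volume := by
    have : gOm D u = D ∩ u ⁻¹' {0}ᶜ := rfl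
    rw [this]
    exact hD.measurableSet.nullMeasurableSet.inter
      (hu.1.1.aemeasurable.nullMeasurable (measurableSet_singleton 0).compl)
  have hsD : gOm D u ⊆ D := fun x hx => hx.1
  rcases trivial_of_gV hD hc hs hsD hcon with h | h
  · rw [h] at heq
    simp at heq
    linarith
  · have h1 : volume D ≤ volume (gOm D u) := by
      calc volume D ≤ volume (D \ gOm D u) + volume (gOm D u) := by
            refine (measure_mono ?_).trans (measure_union_le _ _)
            intro x hx
            by_cases hx' : x ∈ gOm D u
            · exact Or.inr hx'
            · exact Or.inl ⟨hx, hx'⟩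
        _ = _ := by rw [h, zero_add]
    have hfin : volume (gOm D u) ≠ ∞ := ((measure_mono hsD).trans_lt hb.measure_lt_top).ne
    have := ENNReal.toReal_mono hfin h1
    linarith

end GenF

lemma divg_eq_gtr {d : ℕ} (Φ : Euc d → Euc d) (x : Euc d) : divg Φ x = gtr (fderiv ℝ Φ x) := by
  rw [gtr, LinearMap.trace_eq_matrix_trace ℝ (EuclideanSpace.basisFun (Fin d) ℝ).toBasis]
  simp [divg, Matrix.trace, LinearMap.toMatrix_apply]

/-- Euler–Lagrange equation: if `u` minimizes `J` among `w ∈ H¹₀(D)` with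
`|Ω_w| ≤ a`, there exists `Λ ≥ 0` such that for all vector fields `Φ ∈ C^∞₀(D, ℝ^d)`,
`∫ 2(DΦ∇u, ∇u) - ∫ |∇u|² div Φ + λ_a ∫ u² div Φ = Λ ∫_{Ω_u} div Φ`. -/
theorem euler_lagrange_equation
    {d : ℕ} (D : Set (Euc d)) (a lama : ℝ) (u : Euc d → ℝ)
    (hD : IsOpen D) (hDb : Bornology.IsBounded D) (hDc : IsConnected D)
    (ha : 0 < a) (ha' : a < mvol D)
    (hlam : lama = lamOpt D a) (hu : IsJMinimizer D a lama u) :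
    ∃ Λ : ℝ, 0 ≤ Λ ∧ ∀ Φ : Euc d → Euc d, VecTestFun D Φ →
      (∫ x, 2 * ⟪(fderiv ℝ Φ x) (gradient u x), gradient u x⟫)
        - (∫ x, ‖gradient u x‖ ^ 2 * divg Φ x)
        + lama * (∫ x, (u x) ^ 2 * divg Φ x)
        = Λ * ∫ x in Om D u, divg Φ x := by
  obtain ⟨h1, h2, h3⟩ := hu
  obtain ⟨Λ, hΛ, h⟩ := gmain (lam := lama) hD hDb hDc.isPreconnected ha ha' h1 h2 h3
  refine ⟨Λ, hΛ, fun Φ hΦ => ?_⟩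
  simp only [divg_eq_gtr]
  exact h Φ hΦ

end
end
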